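/- Let w = g₁⋯g_n be a primitive, cyclically reduced word over 𝒜 with n ≥ 2, and for 1 ≤ i ≤ n let w_i = g_i⋯g_n g_1⋯g_{i−1} denote its cyclic conjugates (each φ(w_i) is hyperbolic). Then I(w) = (1/4)·Σ_{1 ≤ i,j ≤ n} ε_{ij}·(d_{ij} − 2), where ε_{ij} = 1 if the fixed-point sets of φ(w_i) and φ(w_j) in ℝ ∪ {∞} are linked and ε_{ij} = 0 otherwise, and d_{ij} = |{g_i, ḡ_{i−1}, g_j, ḡ_{j−1}}| is the number of distinct letters among g_i, ḡ_{i−1}, g_j, ḡ_{j−1} (indices mod n, with g₀ = g_n). -/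

import Mathlib

open scoped Classical

abbrev SL2Z := Matrix.SpecialLinearGroup (Fin 2) ℤ

def Amat : SL2Z := ⟨!![1, 2; 0, 1], by norm_num [Matrix.det_fin_two_of]⟩
def Bmat : SL2Z := ⟨!![1, 0; -2, 1], by norm_num [Matrix.det_fin_two_of]⟩
def Cmat : SL2Z := (Amat * Bmat)⁻¹

def Gamma : Subgroup SL2Z := Subgroup.closure {Amat, Bmat}

/-- The real entry `i j` of a matrix in `SL₂(ℤ)`. -/
def entry (g : SL2Z) (i j : Fin 2) : ℝ := ((g : Matrix (Fin 2) (Fin 2) ℤ) i j : ℤ)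

/-- The Möbius action of `SL₂(ℤ)` on the circle `ℝ ∪ {∞}`. -/
noncomputable def mobius (g : SL2Z) (p : OnePoint ℝ) : OnePoint ℝ :=
  Option.rec (motive := fun _ => OnePoint ℝ)
    (if entry g 1 0 = 0 then OnePoint.infty
     else OnePoint.some (entry g 0 0 / entry g 1 0))
    (fun x => if entry g 1 0 * x + entry g 1 1 = 0 then OnePoint.infty
      else OnePoint.some ((entry g 0 0 * x + entry g 0 1) / (entry g 1 0 * x + entry g 1 1)))
    p

/-- The fixed-point set of `g` acting on the circle `ℝ ∪ {∞}`. -/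
noncomputable def fixedSet (g : SL2Z) : Set (OnePoint ℝ) := {p | mobius g p = p}

/-- `g` is hyperbolic if `|trace g| > 2`. -/
def Hyperbolic (g : SL2Z) : Prop := 2 < |Matrix.trace (g : Matrix (Fin 2) (Fin 2) ℤ)|

/-- Two two-element subsets of the circle are linked if the two points of `Q` lie in
different connected components of the complement of `P`. -/
def Linked (P Q : Set (OnePoint ℝ)) : Prop :=
  ∃ q₁ q₂ : OnePoint ℝ, q₁ ≠ q₂ ∧ Q = {q₁, q₂} ∧
    connectedComponentIn Pᶜ q₁ ≠ connectedComponentIn Pᶜ q₂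

/-- `h` contributes to the count `s(v)`: `v` and `h * v * h⁻¹` are hyperbolic with
linked fixed-point sets. -/
def GoodConj (v h : Gamma) : Prop :=
  Hyperbolic (v : SL2Z) ∧ Hyperbolic ((h * v * h⁻¹ : Gamma) : SL2Z) ∧
    Linked (fixedSet (v : SL2Z)) (fixedSet ((h * v * h⁻¹ : Gamma) : SL2Z))

/-- Twice `s(v)`: the number of double cosets `⟨v⟩ h ⟨v⟩` in `Γ` such that `v` and
`h * v * h⁻¹` are hyperbolic with linked fixed-point sets. -/
noncomputable def sTwo (v : Gamma) : ℕ :=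
  Nat.card (Quot (fun h h' : {h : Gamma // GoodConj v h} =>
    ∃ m k : ℤ, (h' : Gamma) = v ^ m * (h : Gamma) * v ^ k))

/-- `v` is not a proper power in `Γ`. -/
def NotProperPower (v : Gamma) : Prop := ¬ ∃ u : Gamma, ∃ k : ℕ, 2 ≤ k ∧ v = u ^ k

/-- The self-intersection number `I(g) = n² s(v) + n - 1`, where `g = vⁿ` with `v` not a
proper power and `n ≥ 1`, and `s(v)` is half the number of good double cosets. -/
noncomputable def Iγ (g : Gamma) : ℤ :=
  if h : ∃ p : Gamma × ℕ, 1 ≤ p.2 ∧ NotProperPower p.1 ∧ g = p.1 ^ p.2 then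
    (h.choose.2 : ℤ) ^ 2 * ((sTwo h.choose.1 / 2 : ℕ) : ℤ) + (h.choose.2 : ℤ) - 1
  else 0
/-- The six-letter alphabet `𝒜 = {a, b, c, ā, b̄, c̄}`. -/
inductive Gen | a | b | c | a' | b' | c'
deriving DecidableEq

/-- The matrix assigned to each letter of `𝒜`. -/
def genM : Gen → SL2Z
  | .a => Amat
  | .b => Bmat
  | .c => Cmat
  | .a' => Amat⁻¹
  | .b' => Bmat⁻¹
  | .c' => Cmat⁻¹

/-- The formal inverse of a letter of `𝒜`. -/
def genInv : Gen → Gen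
  | .a => .a'
  | .a' => .a
  | .b => .b'
  | .b' => .b
  | .c => .c'
  | .c' => .c

/-- The forbidden two-letter subwords: `aā, āa, bb̄, b̄b, cc̄, c̄c, ab, bc, ca, b̄ā, c̄b̄, āc̄`. -/
def BadPair (p q : Gen) : Prop :=
  (p, q) ∈ ([(.a, .a'), (.a', .a), (.b, .b'), (.b', .b), (.c, .c'), (.c', .c),
    (.a, .b), (.b, .c), (.c, .a), (.b', .a'), (.c', .b'), (.a', .c')] : List (Gen × Gen))

/-- The letter of `w` at cyclic position `i`. -/
def cget6 (w : List Gen) (i : ℕ) : Gen := w.getD (i % w.length) Gen.a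

/-- `w` is cyclically reduced: nonempty, and no cyclically consecutive pair of letters is
a forbidden subword. -/
def CyclRed6 (w : List Gen) : Prop :=
  w ≠ [] ∧ ∀ i : ℕ, i < w.length → ¬ BadPair (cget6 w i) (cget6 w (i + 1))

/-- `φ(w)`: the product of the matrices assigned to the letters of `w`. -/
def phi6 (w : List Gen) : SL2Z := (w.map genM).prod

lemma genM_mem (g : Gen) : genM g ∈ Gamma := by
  have hA : Amat ∈ Gamma := Subgroup.subset_closure (by simp)
  have hB : Bmat ∈ Gamma := Subgroup.subset_closure (by simp)
  have hC : Cmat ∈ Gamma := inv_mem (mul_mem hA hB)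
  cases g <;> simp only [genM] <;>
    first
      | exact hA | exact hB | exact hC
      | exact inv_mem hA | exact inv_mem hB | exact inv_mem hC

lemma phi6_mem (w : List Gen) : phi6 w ∈ Gamma := by
  refine Subgroup.list_prod_mem _ ?_
  intro m hm
  rcases List.mem_map.1 hm with ⟨g, -, rfl⟩
  exact genM_mem g

/-- The self-intersection number of the six-letter word `w`. -/
noncomputable def I6 (w : List Gen) : ℤ := Iγ ⟨phi6 w, phi6_mem w⟩

/-- `w` is primitive: as a cyclic word it is not a `k`-fold concatenation of a shorter
word for any `k ≥ 2`. -/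
def Primitive6 (w : List Gen) : Prop :=
  ¬ ∃ u : List Gen, ∃ k : ℕ, 2 ≤ k ∧ u.length < w.length ∧
      ∃ j : ℕ, w.rotate j = (List.replicate k u).flatten

/-- An element of `SL₂(ℤ)` as an invertible real matrix. -/
noncomputable def realGL : SL2Z →* Matrix.GeneralLinearGroup (Fin 2) ℝ :=
  Matrix.SpecialLinearGroup.toGL.comp (Matrix.SpecialLinearGroup.map (Int.castRingHom ℝ))

lemma realGL_apply (g : SL2Z) (i j : Fin 2) : realGL g i j = entry g i j := by
  simp [realGL, entry]

lemma mobius_coe (g : SL2Z) (x : ℝ) : mobius g (x : OnePoint ℝ) =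
    if entry g 1 0 * x + entry g 1 1 = 0 then OnePoint.infty
      else (((entry g 0 0 * x + entry g 0 1) / (entry g 1 0 * x + entry g 1 1) : ℝ) : OnePoint ℝ) :=
  rfl

lemma mobius_infty (g : SL2Z) : mobius g OnePoint.infty =
    if entry g 1 0 = 0 then OnePoint.infty
      else ((entry g 0 0 / entry g 1 0 : ℝ) : OnePoint ℝ) :=
  rfl

lemma mobius_eq_smul (g : SL2Z) (p : OnePoint ℝ) : mobius g p = realGL g • p := by
  induction p using OnePoint.rec with
  | infty => rw [mobius_infty, OnePoint.smul_infty_eq_ite]; simp only [realGL_apply]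
  | coe x => rw [mobius_coe, OnePoint.smul_some_eq_ite]; simp only [realGL_apply]

lemma mobius_mul (g h : SL2Z) (p : OnePoint ℝ) : mobius (g * h) p = mobius g (mobius h p) := by
  simp [mobius_eq_smul, mul_smul]

lemma mobius_one (p : OnePoint ℝ) : mobius 1 p = p := by
  simp [mobius_eq_smul]

lemma mobius_inv_mem_fixedSet {g : SL2Z} {p : OnePoint ℝ} (hp : p ∈ fixedSet g) :
    p ∈ fixedSet g⁻¹ := by
  change mobius g⁻¹ p = p
  conv_lhs => rw [← show mobius g p = p from hp]
  rw [← mobius_mul, inv_mul_cancel, mobius_one]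

lemma mobius_mem_fixedSet_conj {g h : SL2Z} {p : OnePoint ℝ} (hp : p ∈ fixedSet g) :
    mobius h p ∈ fixedSet (h * g * h⁻¹) := by
  change mobius _ _ = _
  rw [← mobius_mul, mul_assoc, mul_assoc, inv_mul_cancel, mul_one, mobius_mul,
    show mobius g p = p from hp]

lemma det_entry (g : SL2Z) : entry g 0 0 * entry g 1 1 - entry g 0 1 * entry g 1 0 = 1 := by
  have := g.det_coe
  rw [Matrix.det_fin_two] at this
  simp only [entry]
  exact_mod_cast this

lemma Hyperbolic.lower_left_ne_zero {g : SL2Z} (hg : Hyperbolic g) : g.1 1 0 ≠ 0 := by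
  intro h
  have h1 := g.det_coe
  rw [Matrix.det_fin_two] at h1
  rw [Hyperbolic, Matrix.trace_fin_two] at hg
  simp only [h, mul_zero, sub_zero] at h1
  rcases Int.eq_one_or_neg_one_of_mul_eq_one' h1 with ⟨h2, h3⟩ | ⟨h2, h3⟩ <;>
    simp [h2, h3] at hg

lemma Hyperbolic.entry_ne_zero {g : SL2Z} (hg : Hyperbolic g) : entry g 1 0 ≠ 0 := by
  simpa [entry] using hg.lower_left_ne_zero

/-- The trace of the commutator `g h g⁻¹ h⁻¹`. -/
def traceComm (g h : SL2Z) : ℤ :=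
  Matrix.trace ((g * h * g⁻¹ * h⁻¹ : SL2Z) : Matrix (Fin 2) (Fin 2) ℤ)

lemma trace_conj (g h : SL2Z) : Matrix.trace ((h * g * h⁻¹ : SL2Z) : Matrix (Fin 2) (Fin 2) ℤ) =
    Matrix.trace (g : Matrix (Fin 2) (Fin 2) ℤ) := by
  rw [Matrix.SpecialLinearGroup.coe_mul, Matrix.trace_mul_comm,
    ← Matrix.SpecialLinearGroup.coe_mul, ← mul_assoc, inv_mul_cancel, one_mul]

lemma traceComm_conj (g h k : SL2Z) : traceComm (k * g * k⁻¹) (k * h * k⁻¹) = traceComm g h := by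
  have : k * g * k⁻¹ * (k * h * k⁻¹) * (k * g * k⁻¹)⁻¹ * (k * h * k⁻¹)⁻¹ =
      k * (g * h * g⁻¹ * h⁻¹) * k⁻¹ := by group
  rw [traceComm, this, trace_conj, traceComm]

lemma traceComm_symm (g h : SL2Z) : traceComm g h = traceComm h g := by
  have key : ∀ k : SL2Z, Matrix.trace ((k⁻¹ : SL2Z) : Matrix (Fin 2) (Fin 2) ℤ) =
      Matrix.trace (k : Matrix (Fin 2) (Fin 2) ℤ) := fun k => by
    simp [Matrix.SpecialLinearGroup.coe_inv, Matrix.adjugate_fin_two, Matrix.trace_fin_two,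
      add_comm]
  have : (g * h * g⁻¹ * h⁻¹)⁻¹ = h * g * h⁻¹ * g⁻¹ := by group
  rw [traceComm, ← key, this, traceComm]

lemma traceComm_of_commute {g h : SL2Z} (H : Commute g h) : traceComm g h = 2 := by
  rw [traceComm, H.eq, mul_assoc h, mul_inv_cancel, mul_one, mul_inv_cancel]
  simp

lemma traceComm_sub_two (g h : SL2Z) : traceComm g h - 2 =
    (g.1 1 0 * h.1 0 1 - h.1 1 0 * g.1 0 1) ^ 2 +
      (g.1 1 0 * (h.1 0 0 - h.1 1 1) - h.1 1 0 * (g.1 0 0 - g.1 1 1)) *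
      (g.1 0 1 * (h.1 0 0 - h.1 1 1) - h.1 0 1 * (g.1 0 0 - g.1 1 1)) * (-1) := by
  have h1 := g.det_coe
  have h2 := h.det_coe
  rw [Matrix.det_fin_two] at h1 h2
  simp only [traceComm, Matrix.trace_fin_two, Matrix.SpecialLinearGroup.coe_mul,
    Matrix.SpecialLinearGroup.coe_inv, Matrix.adjugate_fin_two, Matrix.mul_apply,
    Fin.sum_univ_two, Matrix.of_apply, Matrix.cons_val', Matrix.cons_val_zero,
    Matrix.cons_val_one, Matrix.cons_val_fin_one]
  linear_combination (2 * (h.1 0 0 * h.1 1 1 - h.1 0 1 * h.1 1 0)) * h1 + 2 * h2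

lemma int_not_isSquare_sq_sub_four {t : ℤ} (ht : 2 < |t|) : ¬ IsSquare (t ^ 2 - 4) := by
  rintro ⟨s, hs⟩
  have h1 : |t| ^ 2 = t ^ 2 := sq_abs t
  have h2 : |s| ^ 2 = s ^ 2 := sq_abs s
  have h3 : 0 ≤ |s| := abs_nonneg s
  have h4 : |s| < |t| := by nlinarith
  nlinarith

/-- The fixed points of a hyperbolic element are two irrational numbers. -/
lemma Hyperbolic.exists_fixedSet {g : SL2Z} (hg : Hyperbolic g) : ∃ x y : ℝ, x < y ∧
    Irrational x ∧ Irrational y ∧ fixedSet g = {(x : OnePoint ℝ), (y : OnePoint ℝ)} ∧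
    entry g 1 0 * (x + y) = entry g 0 0 - entry g 1 1 ∧
    entry g 1 0 * (x * y) = - entry g 0 1 := by
  have hc := hg.entry_ne_zero
  have hdet := det_entry g
  have hsq := int_not_isSquare_sq_sub_four hg
  have hpos : (0 : ℤ) ≤ g.1.trace ^ 2 - 4 := by
    have h1 : |g.1.trace| ^ 2 = g.1.trace ^ 2 := sq_abs _
    have h2 : 2 < |g.1.trace| := hg
    nlinarith
  have hirr : Irrational (√((g.1.trace ^ 2 - 4 : ℤ) : ℝ)) := by
    rw [irrational_sqrt_intCast_iff]
    exact ⟨hsq, hpos⟩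
  set r := √((g.1.trace ^ 2 - 4 : ℤ) : ℝ) with hr
  have hrr : r * r = (entry g 0 0 + entry g 1 1) ^ 2 - 4 := by
    rw [hr, Real.mul_self_sqrt (by exact_mod_cast hpos), Matrix.trace_fin_two]
    simp [entry]
  have hrpos : 0 < r := lt_of_le_of_ne (Real.sqrt_nonneg _) (fun h => hirr.ne_zero h.symm)
  have key : ∀ e : ℤ, e ≠ 0 →
      Irrational ((entry g 0 0 - entry g 1 1 + e * r) / (2 * entry g 1 0)) := by
    intro e he
    have := ((hirr.intCast_mul he).intCast_add (g.1 0 0 - g.1 1 1)).div_intCast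
      (m := 2 * g.1 1 0) (by simpa using hg.lower_left_ne_zero)
    simpa [entry] using this
  have hfix : ∀ x : ℝ, (x : OnePoint ℝ) ∈ fixedSet g ↔
      entry g 1 0 * x ^ 2 + (entry g 1 1 - entry g 0 0) * x - entry g 0 1 = 0 := by
    intro x
    change mobius g x = x ↔ _
    rw [mobius_coe]
    split_ifs with h
    · refine ⟨fun h' => absurd h' (OnePoint.infty_ne_coe x), fun h' => ?_⟩
      exfalso
      have : entry g 0 0 * x + entry g 0 1 = 0 := by linear_combination -h' + x * h
      have : (1 : ℝ) = 0 := by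
        linear_combination -hdet - entry g 1 0 * this + entry g 0 0 * h
      exact one_ne_zero this
    · rw [OnePoint.coe_eq_coe, div_eq_iff h]
      constructor <;> intro h' <;> linear_combination -h'
  have hinf : OnePoint.infty ∉ fixedSet g := by
    change ¬ mobius g OnePoint.infty = OnePoint.infty
    rw [mobius_infty, if_neg hc]
    exact OnePoint.coe_ne_infty _
  obtain ⟨x, y, hx, hy, hxy, hs, hp⟩ : ∃ x y : ℝ, Irrational x ∧ Irrational y ∧ x ≠ y ∧
      entry g 1 0 * (x + y) = entry g 0 0 - entry g 1 1 ∧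
      entry g 1 0 * (x * y) = - entry g 0 1 := by
    refine ⟨_, _, key 1 one_ne_zero, key (-1) (by norm_num), ?_, ?_, ?_⟩
    · rw [ne_eq, div_left_inj' (by simpa using hc)]
      push_cast
      intro h
      linarith
    · field_simp
      push_cast
      ring
    · field_simp
      push_cast
      linear_combination -hrr - 4 * hdet
  have hset : fixedSet g = {(x : OnePoint ℝ), (y : OnePoint ℝ)} := by
    ext p
    induction p using OnePoint.rec with
    | infty => simpa using hinf
    | coe z =>
      rw [hfix, Set.mem_insert_iff, Set.mem_singleton_iff, OnePoint.coe_eq_coe, OnePoint.coe_eq_coe,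
        ← sub_eq_zero (a := z) (b := x), ← sub_eq_zero (a := z) (b := y), ← mul_eq_zero,
        ← mul_right_inj' (a := entry g 1 0) hc (b := (z - x) * (z - y)), mul_zero]
      have : entry g 1 0 * ((z - x) * (z - y)) =
          entry g 1 0 * z ^ 2 + (entry g 1 1 - entry g 0 0) * z - entry g 0 1 := by
        linear_combination -z * hs + hp
      rw [this]
  rcases lt_or_gt_of_ne hxy with h | h
  · exact ⟨x, y, h, hx, hy, hset, hs, hp⟩
  · exact ⟨y, x, h, hy, hx, by rw [hset, Set.pair_comm], by rw [add_comm, hs],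
      by rw [mul_comm y, hp]⟩

lemma isPreconnected_coe_image_Ioo (x y : ℝ) :
    IsPreconnected ((↑) '' Set.Ioo x y : Set (OnePoint ℝ)) :=
  isPreconnected_Ioo.image _ OnePoint.continuous_coe.continuousOn

lemma isPreconnected_insert_infty {s : Set ℝ} (hs : IsPreconnected s) {l : Filter ℝ} [l.NeBot]
    (hl : l ≤ Filter.coclosedCompact ℝ) (hsl : s ∈ l) :
    IsPreconnected (insert OnePoint.infty ((↑) '' s : Set (OnePoint ℝ))) := by
  refine (hs.image _ OnePoint.continuous_coe.continuousOn).subset_closure (Set.subset_insert _ _) ?_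
  refine Set.insert_subset ?_ subset_closure
  refine mem_closure_of_tendsto (OnePoint.tendsto_coe_infty.mono_left hl) ?_
  filter_upwards [hsl] with z hz using Set.mem_image_of_mem _ hz

lemma isPreconnected_compl_Icc (x y : ℝ) :
    IsPreconnected (((↑) '' Set.Icc x y : Set (OnePoint ℝ))ᶜ) := by
  have h1 := isPreconnected_insert_infty (isPreconnected_Ioi (a := y)) (l := Filter.atTop)
    (by rw [Filter.coclosedCompact_eq_cocompact]; exact atTop_le_cocompact) (Filter.Ioi_mem_atTop y)
  have h2 := isPreconnected_insert_infty (isPreconnected_Iio (a := x)) (l := Filter.atBot)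
    (by rw [Filter.coclosedCompact_eq_cocompact]; exact atBot_le_cocompact) (Filter.Iio_mem_atBot x)
  have h3 := h1.union OnePoint.infty (Set.mem_insert _ _) (Set.mem_insert _ _) h2
  convert h3 using 1
  ext p
  induction p using OnePoint.rec with
  | infty => simp
  | coe z =>
    simp only [Set.mem_compl_iff, Set.mem_union, Set.mem_insert_iff, OnePoint.coe_ne_infty,
      Set.mem_image, OnePoint.coe_eq_coe, exists_eq_right, Set.mem_Icc, Set.mem_Ioi, Set.mem_Iio,
      false_or]
    rw [not_and_or, not_le, not_le, or_comm]

lemma connectedComponentIn_ne_iff {x y : ℝ} {q r : ℝ} (hq : (q - x) * (q - y) ≠ 0)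
    (hr : (r - x) * (r - y) ≠ 0) (hxy : x < y) :
    connectedComponentIn ({(x : OnePoint ℝ), (y : OnePoint ℝ)}ᶜ) (q : OnePoint ℝ) ≠
      connectedComponentIn ({(x : OnePoint ℝ), (y : OnePoint ℝ)}ᶜ) (r : OnePoint ℝ) ↔
    (q - x) * (q - y) * ((r - x) * (r - y)) < 0 := by
  have mem_compl : ∀ z : ℝ, (z - x) * (z - y) ≠ 0 →
      (z : OnePoint ℝ) ∈ ({(x : OnePoint ℝ), (y : OnePoint ℝ)}ᶜ : Set (OnePoint ℝ)) := by
    intro z hz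
    rw [mul_ne_zero_iff, sub_ne_zero, sub_ne_zero] at hz
    simpa [OnePoint.coe_eq_coe] using hz
  have inside : ∀ z : ℝ, (z - x) * (z - y) < 0 ↔ z ∈ Set.Ioo x y := by
    intro z
    rw [mul_neg_iff, Set.mem_Ioo]
    constructor
    · rintro (h | h)
      · exact ⟨by linarith, by linarith⟩
      · exact ⟨by linarith, by linarith⟩
    · rintro ⟨h1, h2⟩
      exact Or.inl ⟨by linarith, by linarith⟩
  have outside : ∀ z : ℝ, 0 < (z - x) * (z - y) ↔ z ∉ Set.Icc x y := by
    intro z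
    rw [mul_pos_iff, Set.mem_Icc, not_and_or, not_le, not_le]
    constructor
    · rintro (h | h)
      · exact Or.inr (by linarith)
      · exact Or.inl (by linarith)
    · rintro (h | h)
      · exact Or.inr ⟨by linarith, by linarith⟩
      · exact Or.inl ⟨by linarith, by linarith⟩
  have sub1 : ((↑) '' Set.Ioo x y : Set (OnePoint ℝ)) ⊆
      ({(x : OnePoint ℝ), (y : OnePoint ℝ)}ᶜ : Set (OnePoint ℝ)) := by
    rintro _ ⟨z, hz, rfl⟩
    exact mem_compl z ((inside z).2 hz).ne
  have sub2 : ((↑) '' Set.Icc x y : Set (OnePoint ℝ))ᶜ ⊆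
      ({(x : OnePoint ℝ), (y : OnePoint ℝ)}ᶜ : Set (OnePoint ℝ)) := by
    rw [Set.compl_subset_compl]
    rintro _ (rfl | rfl)
    · exact ⟨x, ⟨le_rfl, hxy.le⟩, rfl⟩
    · exact ⟨y, ⟨hxy.le, le_rfl⟩, rfl⟩
  have sep : ∀ q r : ℝ, (q - x) * (q - y) < 0 → 0 < (r - x) * (r - y) →
      connectedComponentIn ({(x : OnePoint ℝ), (y : OnePoint ℝ)}ᶜ) (q : OnePoint ℝ) ≠
      connectedComponentIn ({(x : OnePoint ℝ), (y : OnePoint ℝ)}ᶜ) (r : OnePoint ℝ) := by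
    intro q r hq hr heq
    have hrm := mem_connectedComponentIn (mem_compl r hr.ne')
    rw [← heq] at hrm
    have hqm := mem_connectedComponentIn (mem_compl q hq.ne)
    have hpre := isPreconnected_connectedComponentIn
      (F := ({(x : OnePoint ℝ), (y : OnePoint ℝ)}ᶜ)) (x := (q : OnePoint ℝ))
    obtain ⟨p, -, hp1, hp2⟩ := hpre _ _ (OnePoint.isOpen_image_coe.2 (isOpen_Ioo (a := x) (b := y)))
      (OnePoint.isOpen_compl_image_coe.2 ⟨isClosed_Icc (a := x) (b := y), isCompact_Icc⟩) (by
        intro p hp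
        have hp' := connectedComponentIn_subset _ _ hp
        induction p using OnePoint.rec with
        | infty => right; simp
        | coe z =>
          have hz : z ≠ x ∧ z ≠ y := by simpa [OnePoint.coe_eq_coe] using hp'
          by_cases h : z ∈ Set.Icc x y
          · left
            exact ⟨z, ⟨lt_of_le_of_ne h.1 hz.1.symm, lt_of_le_of_ne h.2 hz.2⟩, rfl⟩
          · right
            simpa [OnePoint.coe_eq_coe] using h)
      ⟨_, hqm, ⟨q, (inside q).1 hq, rfl⟩⟩
      ⟨_, hrm, by simpa [OnePoint.coe_eq_coe] using (outside r).1 hr⟩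
    obtain ⟨z, hz, rfl⟩ := hp1
    exact hp2 ⟨z, Set.Ioo_subset_Icc_self hz, rfl⟩
  rcases lt_or_gt_of_ne hq with h1 | h1 <;> rcases lt_or_gt_of_ne hr with h2 | h2
  · refine iff_of_false (not_not.2 ?_) (not_lt.2 (mul_nonneg_of_nonpos_of_nonpos h1.le h2.le))
    exact connectedComponentIn_eq ((isPreconnected_coe_image_Ioo x y).subset_connectedComponentIn
      ⟨q, (inside q).1 h1, rfl⟩ sub1 ⟨r, (inside r).1 h2, rfl⟩)
  · exact iff_of_true (sep q r h1 h2) (mul_neg_of_neg_of_pos h1 h2)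
  · exact iff_of_true (sep r q h2 h1).symm (mul_neg_of_pos_of_neg h1 h2)
  · refine iff_of_false (not_not.2 ?_) (not_lt.2 (mul_nonneg h1.le h2.le))
    exact connectedComponentIn_eq ((isPreconnected_compl_Icc x y).subset_connectedComponentIn
      (by simpa [OnePoint.coe_eq_coe] using (outside q).1 h1) sub2
      (by simpa [OnePoint.coe_eq_coe] using (outside r).1 h2))

lemma traceComm_eq_prod {g h : SL2Z} {x₁ x₂ y₁ y₂ : ℝ}
    (hgs : entry g 1 0 * (x₁ + x₂) = entry g 0 0 - entry g 1 1)
    (hgp : entry g 1 0 * (x₁ * x₂) = - entry g 0 1)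
    (hhs : entry h 1 0 * (y₁ + y₂) = entry h 0 0 - entry h 1 1)
    (hhp : entry h 1 0 * (y₁ * y₂) = - entry h 0 1) :
    (traceComm g h : ℝ) - 2 = (entry g 1 0 * entry h 1 0) ^ 2 *
      ((y₁ - x₁) * (y₁ - x₂) * ((y₂ - x₁) * (y₂ - x₂))) := by
  have key : (traceComm g h : ℝ) - 2 =
    (entry g 1 0 * entry h 0 1 - entry h 1 0 * entry g 0 1) ^ 2 +
      (entry g 1 0 * (entry h 0 0 - entry h 1 1) - entry h 1 0 * (entry g 0 0 - entry g 1 1)) *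
      (entry g 0 1 * (entry h 0 0 - entry h 1 1) - entry h 0 1 * (entry g 0 0 - entry g 1 1)) *
        (-1) := by
    simp only [entry]
    exact_mod_cast traceComm_sub_two g h
  rw [neg_eq_iff_eq_neg.symm] at hgp hhp
  rw [key, ← hgs, ← hhs, ← hgp, ← hhp]
  ring

lemma two_lt_traceComm {g h : SL2Z} (hg : Hyperbolic g) (hh : Hyperbolic h)
    (H : ∀ x y y' : ℝ, (x : OnePoint ℝ) ∈ fixedSet g → (y : OnePoint ℝ) ∈ fixedSet h →
      (y' : OnePoint ℝ) ∈ fixedSet h → 0 < (y - x) * (y' - x)) : 2 < traceComm g h := by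
  obtain ⟨x₁, x₂, -, -, -, hX, hgs, hgp⟩ := hg.exists_fixedSet
  obtain ⟨y₁, y₂, -, -, -, hY, hhs, hhp⟩ := hh.exists_fixedSet
  have key := traceComm_eq_prod hgs hgp hhs hhp
  have h1 := H x₁ y₁ y₂ (by simp [hX]) (by simp [hY]) (by simp [hY])
  have h2 := H x₂ y₁ y₂ (by simp [hX]) (by simp [hY]) (by simp [hY])
  have h3 : 0 < (entry g 1 0 * entry h 1 0) ^ 2 := by
    have := mul_ne_zero hg.entry_ne_zero hh.entry_ne_zero
    positivity
  have h4 := mul_pos h3 (mul_pos h1 h2)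
  have : (2 : ℝ) < traceComm g h := by
    rw [← sub_pos, key]
    linarith
  exact_mod_cast this

/-- Hyperbolic elements of `SL₂(ℤ)` sharing a fixed point share both. -/
lemma eq_of_common_fixed {g h : SL2Z} (hg : Hyperbolic g) (hh : Hyperbolic h)
    {z x₂ y₂ : ℝ} (hz : Irrational z)
    (hgs : entry g 1 0 * (z + x₂) = entry g 0 0 - entry g 1 1)
    (hgp : entry g 1 0 * (z * x₂) = - entry g 0 1)
    (hhs : entry h 1 0 * (z + y₂) = entry h 0 0 - entry h 1 1)
    (hhp : entry h 1 0 * (z * y₂) = - entry h 0 1) : x₂ = y₂ := by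
  have hc := hg.entry_ne_zero
  have hc' := hh.entry_ne_zero
  set m : ℤ := h.1 1 0 * (g.1 0 0 - g.1 1 1) - g.1 1 0 * (h.1 0 0 - h.1 1 1) with hm
  have hmR : (m : ℝ) = entry h 1 0 * (entry g 0 0 - entry g 1 1) -
      entry g 1 0 * (entry h 0 0 - entry h 1 1) := by
    simp [hm, entry]
  have key : z * (m : ℝ) = ((g.1 1 0 * h.1 0 1 - h.1 1 0 * g.1 0 1 : ℤ) : ℝ) := by
    have : ((g.1 1 0 * h.1 0 1 - h.1 1 0 * g.1 0 1 : ℤ) : ℝ) =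
        entry g 1 0 * entry h 0 1 - entry h 1 0 * entry g 0 1 := by simp [entry]
    rw [this, hmR]
    linear_combination (-z * entry h 1 0) * hgs + (z * entry g 1 0) * hhs +
      entry h 1 0 * hgp - entry g 1 0 * hhp
  have hm0 : m = 0 := by
    by_contra hne
    exact (hz.mul_intCast hne).ne_int _ key
  rw [hm0, Int.cast_zero] at hmR
  have : entry g 1 0 * entry h 1 0 * (x₂ - y₂) = 0 := by
    linear_combination entry h 1 0 * hgs - entry g 1 0 * hhs - hmR
  rcases mul_eq_zero.1 this with h | h
  · exact absurd h (mul_ne_zero hc hc')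
  · linarith

lemma not_linked_self (P : Set (OnePoint ℝ)) : ¬ Linked P P := by
  rintro ⟨q₁, q₂, -, hP, hne⟩
  have h1 : q₁ ∉ Pᶜ := by simp [hP]
  have h2 : q₂ ∉ Pᶜ := by simp [hP]
  rw [connectedComponentIn_eq_empty h1, connectedComponentIn_eq_empty h2] at hne
  exact hne rfl

/-- The axes of two hyperbolic elements cross iff their commutator has trace less than `2`. -/
lemma linked_iff {g h : SL2Z} (hg : Hyperbolic g) (hh : Hyperbolic h) :
    Linked (fixedSet g) (fixedSet h) ↔ traceComm g h < 2 := by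
  obtain ⟨x₁, x₂, hx, ix₁, ix₂, hX, hgs, hgp⟩ := hg.exists_fixedSet
  obtain ⟨y₁, y₂, hy, iy₁, iy₂, hY, hhs, hhp⟩ := hh.exists_fixedSet
  have key := traceComm_eq_prod hgs hgp hhs hhp
  have hpos : 0 < (entry g 1 0 * entry h 1 0) ^ 2 := by
    have := mul_ne_zero hg.entry_ne_zero hh.entry_ne_zero
    positivity
  have hiff : traceComm g h < 2 ↔
      (y₁ - x₁) * (y₁ - x₂) * ((y₂ - x₁) * (y₂ - x₂)) < 0 := by
    rw [← @Int.cast_lt ℝ, ← sub_neg, Int.cast_ofNat, key, mul_neg_iff]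
    constructor
    · rintro (h | h)
      · exact h.2
      · exact absurd h.1 (not_lt.2 hpos.le)
    · exact fun h => Or.inl ⟨hpos, h⟩
  rw [hiff]
  by_cases h0 : (y₁ - x₁) * (y₁ - x₂) * ((y₂ - x₁) * (y₂ - x₂)) = 0
  · refine iff_of_false ?_ (by rw [h0]; exact lt_irrefl 0)
    have : fixedSet g = fixedSet h := by
      rw [hX, hY]
      have hgs' : entry g 1 0 * (x₂ + x₁) = entry g 0 0 - entry g 1 1 := by rw [add_comm, hgs]
      have hgp' : entry g 1 0 * (x₂ * x₁) = - entry g 0 1 := by rw [mul_comm x₂, hgp]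
      have hhs' : entry h 1 0 * (y₂ + y₁) = entry h 0 0 - entry h 1 1 := by rw [add_comm, hhs]
      have hhp' : entry h 1 0 * (y₂ * y₁) = - entry h 0 1 := by rw [mul_comm y₂, hhp]
      rcases mul_eq_zero.1 h0 with h1 | h1 <;> rcases mul_eq_zero.1 h1 with h2 | h2 <;>
        obtain rfl := sub_eq_zero.1 h2
      · rw [eq_of_common_fixed hg hh ix₁ hgs hgp hhs hhp]
      · rw [eq_of_common_fixed hg hh ix₂ hgs' hgp' hhs hhp, Set.pair_comm]
      · rw [eq_of_common_fixed hg hh ix₁ hgs hgp hhs' hhp', Set.pair_comm]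
      · rw [eq_of_common_fixed hg hh ix₂ hgs' hgp' hhs' hhp']
    rw [this]
    exact not_linked_self _
  · obtain ⟨n1, n2⟩ := mul_ne_zero_iff.1 h0
    constructor
    · rintro ⟨q₁, q₂, -, hQ, hne⟩
      rw [hY, Set.pair_eq_pair_iff] at hQ
      rw [hX] at hne
      rcases hQ with ⟨rfl, rfl⟩ | ⟨rfl, rfl⟩
      · exact (connectedComponentIn_ne_iff n1 n2 hx).1 hne
      · exact (connectedComponentIn_ne_iff n1 n2 hx).1 hne.symm
    · intro hlt
      refine ⟨y₁, y₂, fun h => hy.ne (OnePoint.coe_injective h), hY, ?_⟩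
      rw [hX]
      exact (connectedComponentIn_ne_iff n1 n2 hx).2 hlt

/-- Elements commuting with a common non-central element commute. -/
lemma commute_of_commute_of_ne {g h t : SL2Z} (hg : Commute g t) (hh : Commute h t)
    (ht : t ^ 2 ≠ 1) : Commute g h := by
  have coords : ∀ {u v : SL2Z}, Commute u v ↔
      u.1 0 1 * v.1 1 0 = v.1 0 1 * u.1 1 0 ∧
      u.1 0 1 * (v.1 0 0 - v.1 1 1) = v.1 0 1 * (u.1 0 0 - u.1 1 1) ∧
      u.1 1 0 * (v.1 0 0 - v.1 1 1) = v.1 1 0 * (u.1 0 0 - u.1 1 1) := by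
    intro u v
    rw [commute_iff_eq, Matrix.SpecialLinearGroup.ext_iff]
    simp only [Matrix.SpecialLinearGroup.coe_mul, Matrix.mul_apply, Fin.sum_univ_two,
      Fin.forall_fin_two]
    constructor
    · rintro ⟨⟨h1, h2⟩, h3, h4⟩
      refine ⟨?_, ?_, ?_⟩ <;> linarith
    · rintro ⟨h1, h2, h3⟩
      refine ⟨⟨?_, ?_⟩, ?_, ?_⟩ <;> linarith
  have hne : t.1 0 1 ≠ 0 ∨ t.1 1 0 ≠ 0 ∨ t.1 0 0 - t.1 1 1 ≠ 0 := by
    by_contra! hcon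
    obtain ⟨h1, h2, h3⟩ := hcon
    have hdet := t.det_coe
    rw [Matrix.det_fin_two] at hdet
    apply ht
    rw [Matrix.SpecialLinearGroup.ext_iff]
    simp only [pow_two, Matrix.SpecialLinearGroup.coe_mul, Matrix.mul_apply, Fin.sum_univ_two,
      Fin.forall_fin_two, Matrix.SpecialLinearGroup.coe_one, Matrix.one_apply_eq]
    have h3' := sub_eq_zero.1 h3
    simp only [h1, h2, h3', mul_zero, zero_mul, sub_zero, add_zero, zero_add] at hdet ⊢
    simp [hdet]
  rw [coords] at hg hh ⊢
  obtain ⟨a1, a2, a3⟩ := hg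
  obtain ⟨b1, b2, b3⟩ := hh
  rcases hne with h | h | h
  · refine ⟨?_, ?_, ?_⟩ <;> apply mul_left_cancel₀ h <;> grind
  · refine ⟨?_, ?_, ?_⟩ <;> apply mul_left_cancel₀ h <;> grind
  · refine ⟨?_, ?_, ?_⟩ <;> apply mul_left_cancel₀ h <;> grind

/-- The open arc of the circle containing the ends of all reduced words with a given first
letter. -/
def arc : Gen → Set ℝ
  | .a => Set.Ioi 2
  | .b => Set.Ioo (-1) 0
  | .c => Set.Ioo (1 / 2) 1
  | .a' => Set.Iio (-1)
  | .b' => Set.Ioo 0 (1 / 2)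
  | .c' => Set.Ioo 1 2

/-- Two letters have the same `side` iff they are equal or span a triangle of the Cayley graph at
the identity. -/
def side : Gen → Fin 3
  | .a => 0
  | .c' => 0
  | .b => 1
  | .a' => 1
  | .c => 2
  | .b' => 2

lemma genInv_genInv (p : Gen) : genInv (genInv p) = p := by
  cases p <;> rfl

lemma genM_genInv (p : Gen) : genM (genInv p) = (genM p)⁻¹ := by
  cases p <;> simp [genM, genInv]

lemma badPair_iff (p q : Gen) : BadPair p q ↔ side q = side (genInv p) := by
  cases p <;> cases q <;> simp [BadPair, side, genInv]

lemma badPair_genInv {p q : Gen} : BadPair (genInv q) (genInv p) ↔ BadPair p q := by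
  rw [badPair_iff, badPair_iff, genInv_genInv, eq_comm]

lemma arc_nonempty (p : Gen) : (arc p).Nonempty := by
  cases p <;> simp only [arc]
  · exact Set.nonempty_Ioi
  · exact Set.nonempty_Ioo.2 (by norm_num)
  · exact Set.nonempty_Ioo.2 (by norm_num)
  · exact Set.nonempty_Iio
  · exact Set.nonempty_Ioo.2 (by norm_num)
  · exact Set.nonempty_Ioo.2 (by norm_num)

lemma arc_disjoint {p q : Gen} {x : ℝ} (hp : x ∈ arc p) (hq : x ∈ arc q) : p = q := by
  cases p <;> cases q <;> first | rfl | skip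
  all_goals
    exfalso
    simp only [arc, Set.mem_Ioi, Set.mem_Iio, Set.mem_Ioo] at hp hq
    linarith [hp, hq]

lemma exists_mem_arc {x : ℝ} (hx : Irrational x) : ∃ p, x ∈ arc p := by
  by_contra! h
  have ha := h .a
  have hb := h .b
  have hc := h .c
  have ha' := h .a'
  have hb' := h .b'
  have hc' := h .c'
  simp only [arc, Set.mem_Ioi, Set.mem_Iio, Set.mem_Ioo, not_and, not_lt] at ha hb hc ha' hb' hc'
  have h0 : x ≠ 0 := hx.ne_zero
  have h1 : x ≠ 1 := hx.ne_one
  have h2 : x ≠ 2 := by simpa using hx.ne_nat 2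
  have h3 : x ≠ -1 := by simpa using hx.ne_int (-1)
  have h4 : x ≠ 1 / 2 := by simpa using hx.ne_rational 1 2
  rcases lt_or_gt_of_ne h3 with h3 | h3
  · linarith
  rcases lt_or_gt_of_ne h0 with h0 | h0
  · linarith [hb h3]
  rcases lt_or_gt_of_ne h4 with h4 | h4
  · linarith [hb' h0]
  rcases lt_or_gt_of_ne h1 with h1 | h1
  · linarith [hc h4]
  rcases lt_or_gt_of_ne h2 with h2 | h2
  · linarith [hc' h1]
  · linarith

lemma arc_side_separated {z₁ z₂ s : Gen} (hz : side z₁ = side z₂) (h1 : s ≠ z₁) (h2 : s ≠ z₂)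
    {x y₁ y₂ : ℝ} (hx : x ∈ arc s) (hy₁ : y₁ ∈ arc z₁) (hy₂ : y₂ ∈ arc z₂) :
    0 < (y₁ - x) * (y₂ - x) := by
  have key : (x < y₁ ∧ x < y₂) ∨ (y₁ < x ∧ y₂ < x) := by
    cases z₁ <;> cases z₂ <;> first | (exfalso; revert hz; decide) | skip
    all_goals
      cases s <;> first | exact absurd rfl h1 | exact absurd rfl h2 | skip
      all_goals
        simp only [arc, Set.mem_Ioi, Set.mem_Iio, Set.mem_Ioo] at hx hy₁ hy₂
        first
          | (left; constructor <;> linarith [hx, hy₁, hy₂])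
          | (right; constructor <;> linarith [hx, hy₁, hy₂])
  rcases key with ⟨h, h'⟩ | ⟨h, h'⟩
  · exact mul_pos (by linarith) (by linarith)
  · exact mul_pos_of_neg_of_neg (by linarith) (by linarith)

lemma mobius_mem_of_div {g : SL2Z} {x n d : ℝ} {s : Set ℝ}
    (hn : n = entry g 0 0 * x + entry g 0 1) (hd : d = entry g 1 0 * x + entry g 1 1)
    (hd0 : d ≠ 0) (h : n / d ∈ s) : mobius g x ∈ ((↑) '' s : Set (OnePoint ℝ)) := by
  rw [mobius_coe, ← hn, ← hd, if_neg hd0]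
  exact ⟨_, h, rfl⟩

/-- The explicit matrix assigned to a letter. -/
def letterMatrix : Gen → Matrix (Fin 2) (Fin 2) ℤ
  | .a => !![1, 2; 0, 1]
  | .b => !![1, 0; -2, 1]
  | .c => !![1, -2; 2, -3]
  | .a' => !![1, -2; 0, 1]
  | .b' => !![1, 0; 2, 1]
  | .c' => !![-3, 2; -2, 1]

lemma coe_genM (p : Gen) : ((genM p : SL2Z) : Matrix (Fin 2) (Fin 2) ℤ) = letterMatrix p := by
  cases p <;> decide

lemma arc_step {p q : Gen} (h : ¬ BadPair p q) {x : ℝ} (hx : x ∈ arc q) :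
    mobius (genM p) x ∈ ((↑) '' arc p : Set (OnePoint ℝ)) := by
  rw [badPair_iff] at h
  cases p <;> cases q <;> first | exact absurd rfl h | skip
  all_goals
    simp only [arc, Set.mem_Ioi, Set.mem_Iio, Set.mem_Ioo] at hx
    refine mobius_mem_of_div rfl rfl ?_ ?_ <;>
      simp only [entry, coe_genM, letterMatrix, arc, Matrix.of_apply, Matrix.cons_val',
        Matrix.cons_val_zero, Matrix.cons_val_one, Matrix.cons_val_fin_one, Int.cast_zero,
        Int.cast_one, Int.cast_neg, Int.cast_ofNat, Set.mem_Ioi, Set.mem_Iio, Set.mem_Ioo]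
    · intro h0
      linarith [hx, h0]
    · first
        | (constructor <;> first
            | (rw [lt_div_iff₀ (by linarith [hx])]; linarith [hx])
            | (rw [lt_div_iff_of_neg (by linarith [hx])]; linarith [hx])
            | (rw [div_lt_iff₀ (by linarith [hx])]; linarith [hx])
            | (rw [div_lt_iff_of_neg (by linarith [hx])]; linarith [hx]))
        | (rw [lt_div_iff₀ (by linarith [hx])]; linarith [hx])
        | (rw [div_lt_iff₀ (by linarith [hx])]; linarith [hx])

lemma mobius_arc_of_eq {p q m : Gen}
    (H : (p, q, m) ∈ ([(.a, .b, .c'), (.b, .c, .a'), (.c, .a, .b'), (.b', .a', .c),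
      (.c', .b', .a), (.a', .c', .b)] : List (Gen × Gen × Gen))) {x : ℝ} (hx : x ∈ arc q) :
    mobius (genM p) x ∈ ((↑) '' arc m : Set (OnePoint ℝ)) := by
  simp only [List.mem_cons, Prod.mk.injEq, List.not_mem_nil, or_false] at H
  rcases H with H | H | H | H | H | H <;> obtain ⟨rfl, rfl, rfl⟩ := H
  all_goals
    simp only [arc, Set.mem_Ioi, Set.mem_Iio, Set.mem_Ioo] at hx
    refine mobius_mem_of_div rfl rfl ?_ ?_ <;>
      simp only [entry, coe_genM, letterMatrix, arc, Matrix.of_apply, Matrix.cons_val',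
        Matrix.cons_val_zero, Matrix.cons_val_one, Matrix.cons_val_fin_one, Int.cast_zero,
        Int.cast_one, Int.cast_neg, Int.cast_ofNat, Set.mem_Ioi, Set.mem_Iio, Set.mem_Ioo]
    · intro h0
      linarith [hx, h0]
    · first
        | (constructor <;> first
            | (rw [lt_div_iff₀ (by linarith [hx])]; linarith [hx])
            | (rw [lt_div_iff_of_neg (by linarith [hx])]; linarith [hx])
            | (rw [div_lt_iff₀ (by linarith [hx])]; linarith [hx])
            | (rw [div_lt_iff_of_neg (by linarith [hx])]; linarith [hx]))
        | (rw [lt_div_iff₀ (by linarith [hx])]; linarith [hx])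
        | (rw [div_lt_iff_of_neg (by linarith [hx])]; linarith [hx])

/-- A bad pair either cancels or collapses to a single letter in the triangle of its first
letter. -/
lemma BadPair.cases {p q : Gen} (h : BadPair p q) : q = genInv p ∨
    ∃ m, side m = side p ∧ genM p * genM q = genM m ∧
      ∀ x ∈ arc q, mobius (genM p) x ∈ ((↑) '' arc m : Set (OnePoint ℝ)) := by
  have key : ∀ m : Gen, (p, q, m) ∈ ([(.a, .b, .c'), (.b, .c, .a'), (.c, .a, .b'), (.b', .a', .c),
      (.c', .b', .a), (.a', .c', .b)] : List (Gen × Gen × Gen)) →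
      side m = side p ∧ genM p * genM q = genM m := by
    intro m H
    simp only [List.mem_cons, Prod.mk.injEq, List.not_mem_nil, or_false] at H
    rcases H with H | H | H | H | H | H <;> obtain ⟨rfl, rfl, rfl⟩ := H <;>
      simp [side, genM, Cmat]
  rw [badPair_iff] at h
  have hex : q = genInv p ∨ ∃ m : Gen, (p, q, m) ∈ ([(.a, .b, .c'), (.b, .c, .a'), (.c, .a, .b'),
      (.b', .a', .c), (.c', .b', .a), (.a', .c', .b)] : List (Gen × Gen × Gen)) := by
    cases p <;> cases q <;> first | exact Or.inl rfl | (exfalso; revert h; decide) | skip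
    · exact Or.inr ⟨.c', by simp⟩
    · exact Or.inr ⟨.a', by simp⟩
    · exact Or.inr ⟨.b', by simp⟩
    · exact Or.inr ⟨.b, by simp⟩
    · exact Or.inr ⟨.c, by simp⟩
    · exact Or.inr ⟨.a, by simp⟩
  rcases hex with h | ⟨m, hm⟩
  · exact Or.inl h
  · exact Or.inr ⟨m, (key m hm).1, (key m hm).2, fun x hx => mobius_arc_of_eq hm hx⟩

lemma phi6_nil : phi6 [] = 1 := rfl

lemma phi6_cons (p : Gen) (u : List Gen) : phi6 (p :: u) = genM p * phi6 u := by
  simp [phi6]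

lemma phi6_append (u v : List Gen) : phi6 (u ++ v) = phi6 u * phi6 v := by
  simp [phi6]

/-- A word without forbidden two-letter subwords. -/
def Reduced (u : List Gen) : Prop := u.IsChain (fun p q => ¬ BadPair p q)

lemma mobius_phi6_mem {e : Gen} {x : ℝ} (hx : x ∈ arc e) (u : List Gen) (p : Gen)
    (h : Reduced (p :: (u ++ [e]))) :
    mobius (phi6 (p :: u)) x ∈ ((↑) '' arc p : Set (OnePoint ℝ)) := by
  induction u generalizing p with
  | nil =>
    simp only [Reduced, List.nil_append, List.isChain_cons_cons] at h
    rw [phi6_cons, phi6_nil, mul_one]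
    exact arc_step h.1 hx
  | cons r u ih =>
    simp only [Reduced, List.cons_append, List.isChain_cons_cons] at h
    obtain ⟨y, hy, hy'⟩ := ih r h.2
    rw [phi6_cons, mobius_mul, ← hy']
    exact arc_step h.1 hy

lemma exists_not_badPair (i j k : Gen) : ∃ e, ¬ BadPair i e ∧ ¬ BadPair j e ∧ (e ≠ k ∨ i ≠ j) := by
  simp only [badPair_iff]
  cases i <;> cases j <;> cases k <;>
    first | exact ⟨.a, by decide⟩ | exact ⟨.b, by decide⟩ | exact ⟨.c, by decide⟩

lemma Reduced.append_singleton {p e : Gen} {u : List Gen} (h : Reduced (p :: u))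
    (he : ¬ BadPair ((p :: u).getLast (List.cons_ne_nil _ _)) e) :
    Reduced (p :: (u ++ [e])) := by
  rw [Reduced, ← List.cons_append, List.isChain_append]
  refine ⟨h, List.isChain_singleton _, ?_⟩
  intro x hx y hy
  rw [List.getLast?_eq_some_getLast (List.cons_ne_nil _ _)] at hx
  simp only [Option.mem_def, Option.some.injEq, List.head?_cons] at hx hy
  rwa [← hx, ← hy]

lemma phi6_cons_ne_one {p : Gen} {u : List Gen} (h : Reduced (p :: u)) : phi6 (p :: u) ≠ 1 := by
  intro h1
  obtain ⟨e, he, -, hep⟩ := exists_not_badPair ((p :: u).getLast (List.cons_ne_nil _ _))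
    ((p :: u).getLast (List.cons_ne_nil _ _)) p
  obtain ⟨x, hx⟩ := arc_nonempty e
  obtain ⟨y, hy, hy'⟩ := mobius_phi6_mem hx u p (h.append_singleton he)
  rw [h1, mobius_one, OnePoint.coe_eq_coe] at hy'
  subst hy'
  exact hep.elim (fun H => H (arc_disjoint hx hy)) (fun H => H rfl)

lemma Reduced.head_eq {p q : Gen} {u u' : List Gen} (h : Reduced (p :: u)) (h' : Reduced (q :: u'))
    (heq : phi6 (p :: u) = phi6 (q :: u')) : p = q := by
  obtain ⟨e, he, he', -⟩ := exists_not_badPair ((p :: u).getLast (List.cons_ne_nil _ _))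
    ((q :: u').getLast (List.cons_ne_nil _ _)) p
  obtain ⟨x, hx⟩ := arc_nonempty e
  obtain ⟨y, hy, hxy⟩ := mobius_phi6_mem hx u p (h.append_singleton he)
  obtain ⟨z, hz, hxz⟩ := mobius_phi6_mem hx u' q (h'.append_singleton he')
  rw [heq, ← hxz, OnePoint.coe_eq_coe] at hxy
  subst hxy
  exact arc_disjoint hy hz

lemma Reduced.tail {p : Gen} {u : List Gen} (h : Reduced (p :: u)) : Reduced u :=
  (List.isChain_cons.1 h).2

lemma phi6_injOn {u u' : List Gen} (h : Reduced u) (h' : Reduced u') (heq : phi6 u = phi6 u') :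
    u = u' := by
  induction u generalizing u' with
  | nil =>
    cases u' with
    | nil => rfl
    | cons q u' => exact absurd heq.symm (phi6_cons_ne_one h')
  | cons p u ih =>
    cases u' with
    | nil => exact absurd heq (phi6_cons_ne_one h)
    | cons q u' =>
      obtain rfl := h.head_eq h' heq
      rw [phi6_cons, phi6_cons, mul_right_inj] at heq
      rw [ih h.tail h'.tail heq]

lemma exists_shorter {u : List Gen} (h : ¬ Reduced u) :
    ∃ u', u'.length < u.length ∧ phi6 u' = phi6 u := by
  induction u with
  | nil => exact absurd List.isChain_nil h
  | cons p u ih =>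
    by_cases hu : Reduced u
    · cases u with
      | nil => exact absurd (List.isChain_singleton p) h
      | cons q u =>
        rw [Reduced, List.isChain_cons_cons] at h
        have hb : BadPair p q := by
          by_contra hb
          exact h ⟨hb, hu⟩
        rcases hb.cases with rfl | ⟨m, -, hm, -⟩
        · exact ⟨u, by simp, by simp [phi6_cons, genM_genInv]⟩
        · exact ⟨m :: u, by simp, by rw [phi6_cons, phi6_cons, phi6_cons, ← hm, mul_assoc]⟩
    · obtain ⟨u', hlt, he⟩ := ih hu
      exact ⟨p :: u', by simpa using hlt, by rw [phi6_cons, phi6_cons, he]⟩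

lemma exists_phi6_eq {g : SL2Z} (hg : g ∈ Gamma) : ∃ u, phi6 u = g := by
  induction hg using Subgroup.closure_induction with
  | mem x hx =>
    rcases hx with rfl | rfl
    · exact ⟨[.a], by simp [phi6, genM]⟩
    · exact ⟨[.b], by simp [phi6, genM]⟩
  | one => exact ⟨[], rfl⟩
  | mul x y _ _ hx hy =>
    obtain ⟨u, rfl⟩ := hx
    obtain ⟨u', rfl⟩ := hy
    exact ⟨u ++ u', phi6_append _ _⟩
  | inv x _ hx =>
    obtain ⟨u, rfl⟩ := hx
    clear * -
    refine ⟨(u.map genInv).reverse, ?_⟩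
    induction u with
    | nil => simp [phi6]
    | cons p u ih =>
      rw [List.map_cons, List.reverse_cons, phi6_append, ih]
      simp [phi6_cons, phi6_nil, genM_genInv]

/-- A bi-infinite path in the Cayley graph all of whose finite subwords are reduced. -/
structure IsLine (q : ℤ → SL2Z) (H : ℤ → Gen) : Prop where
  step : ∀ t, q (t + 1) = q t * genM (H t)
  not_bad : ∀ t, ¬ BadPair (H t) (H (t + 1))

namespace IsLine

variable {q q' : ℤ → SL2Z} {H H' : ℤ → Gen}

lemma shift (hq : IsLine q H) (k : ℤ) : IsLine (fun t => q (t + k)) (fun t => H (t + k)) where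
  step t := by rw [← hq.step, add_right_comm]
  not_bad t := by rw [add_right_comm]; exact hq.not_bad _

lemma smul (hq : IsLine q H) (g : SL2Z) : IsLine (fun t => g * q t) H where
  step t := by rw [hq.step, mul_assoc]
  not_bad := hq.not_bad

lemma reverse (hq : IsLine q H) : IsLine (fun t => q (-t)) (fun t => genInv (H (-t - 1))) where
  step t := by
    have := hq.step (-t - 1)
    rw [sub_add_cancel] at this
    rw [this, genM_genInv, mul_assoc, mul_inv_cancel, mul_one, neg_add']
  not_bad t := by
    rw [badPair_genInv, neg_add']
    have := hq.not_bad (-(t + 1) - 1)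
    rwa [sub_add_cancel, show -(t + 1) = -t - 1 by ring] at this

/-- The word read along the first `m` steps of a line. -/
def word (H : ℤ → Gen) (m : ℕ) : List Gen := (List.range m).map fun t : ℕ => H t

lemma eq_mul_phi6 (hq : IsLine q H) (m : ℕ) : q m = q 0 * phi6 (word H m) := by
  induction m with
  | zero => simp [word, phi6_nil]
  | succ m ih =>
    rw [Nat.cast_succ, hq.step, ih, mul_assoc]
    simp [word, phi6, List.range_succ]

lemma reduced_word (hq : IsLine q H) (m : ℕ) : Reduced (word H m) := by
  rw [Reduced, List.isChain_iff_getElem]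
  intro i hi
  simpa [word] using hq.not_bad i

lemma sync (hq : IsLine q H) (hq' : IsLine q' H') (h0 : q 0 = q' 0) {m m' : ℕ}
    (hm : q m = q' m') : m = m' ∧ ∀ t < m, H t = H' t := by
  rw [hq.eq_mul_phi6, hq'.eq_mul_phi6, h0, mul_right_inj] at hm
  have h := phi6_injOn (hq.reduced_word m) (hq'.reduced_word m') hm
  have hlen := congrArg List.length h
  simp only [word, List.length_map, List.length_range] at hlen
  refine ⟨hlen, fun t ht => ?_⟩
  subst hlen
  have := List.map_inj_left.1 h t (List.mem_range.2 ht)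
  exact this

lemma injective (hq : IsLine q H) : Function.Injective q := by
  have key : ∀ k (m : ℕ), q (k + m) = q k → m = 0 := by
    intro k m h
    refine ((hq.shift k).sync (hq.shift k) rfl (m := m) (m' := 0) ?_).1
    simpa [add_comm] using h
  intro k l h
  rcases le_total k l with hkl | hkl
  · obtain ⟨m, rfl⟩ := Int.le.dest hkl
    simp [key k m h.symm]
  · obtain ⟨m, rfl⟩ := Int.le.dest hkl
    simp [key l m h]

end IsLine

/-- All entries have the same weak sign. -/
def Semipos (g : SL2Z) : Prop :=
  (∀ i j, 0 ≤ (g : Matrix (Fin 2) (Fin 2) ℤ) i j) ∨ ∀ i j, (g : Matrix (Fin 2) (Fin 2) ℤ) i j ≤ 0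

namespace Semipos

variable {g h : SL2Z}

lemma mul_off_diag_nonneg (hg : Semipos g) :
    0 ≤ (g : Matrix (Fin 2) (Fin 2) ℤ) 0 1 * (g : Matrix (Fin 2) (Fin 2) ℤ) 1 0 := by
  rcases hg with hg | hg
  · exact mul_nonneg (hg _ _) (hg _ _)
  · exact mul_nonneg_of_nonpos_of_nonpos (hg _ _) (hg _ _)

lemma diag_ne_zero (hg : Semipos g) :
    (g : Matrix (Fin 2) (Fin 2) ℤ) 0 0 ≠ 0 ∧ (g : Matrix (Fin 2) (Fin 2) ℤ) 1 1 ≠ 0 := by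
  have hdet := g.det_coe
  rw [Matrix.det_fin_two] at hdet
  have := hg.mul_off_diag_nonneg
  constructor <;> intro h0 <;> simp [h0] at hdet <;> omega

lemma mul (hg : Semipos g) (hh : Semipos h) : Semipos (g * h) := by
  rcases hg with hg | hg <;> rcases hh with hh | hh
  · left
    intro i j
    rw [Matrix.SpecialLinearGroup.coe_mul, Matrix.mul_apply]
    exact Finset.sum_nonneg fun k _ => mul_nonneg (hg _ _) (hh _ _)
  · right
    intro i j
    rw [Matrix.SpecialLinearGroup.coe_mul, Matrix.mul_apply]
    exact Finset.sum_nonpos fun k _ => mul_nonpos_of_nonneg_of_nonpos (hg _ _) (hh _ _)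
  · right
    intro i j
    rw [Matrix.SpecialLinearGroup.coe_mul, Matrix.mul_apply]
    exact Finset.sum_nonpos fun k _ => mul_nonpos_of_nonpos_of_nonneg (hg _ _) (hh _ _)
  · left
    intro i j
    rw [Matrix.SpecialLinearGroup.coe_mul, Matrix.mul_apply]
    exact Finset.sum_nonneg fun k _ => mul_nonneg_of_nonpos_of_nonpos (hg _ _) (hh _ _)

lemma off_diag_eq_zero (hg : Semipos g) (hh : Semipos h) {i j : Fin 2} (hij : i ≠ j)
    (H : ((g * h : SL2Z) : Matrix (Fin 2) (Fin 2) ℤ) i j = 0) :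
    (g : Matrix (Fin 2) (Fin 2) ℤ) i j = 0 ∧ (h : Matrix (Fin 2) (Fin 2) ℤ) i j = 0 := by
  have hgd := hg.diag_ne_zero
  have hhd := hh.diag_ne_zero
  have hg' : (g : Matrix (Fin 2) (Fin 2) ℤ) i i ≠ 0 := by fin_cases i; exacts [hgd.1, hgd.2]
  have hh' : (h : Matrix (Fin 2) (Fin 2) ℤ) j j ≠ 0 := by fin_cases j; exacts [hhd.1, hhd.2]
  have hsum : (g : Matrix (Fin 2) (Fin 2) ℤ) i i * (h : Matrix (Fin 2) (Fin 2) ℤ) i j +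
      (g : Matrix (Fin 2) (Fin 2) ℤ) i j * (h : Matrix (Fin 2) (Fin 2) ℤ) j j = 0 := by
    rw [← H, Matrix.SpecialLinearGroup.coe_mul, Matrix.mul_apply, Fin.sum_univ_two]
    fin_cases i <;> fin_cases j <;> first | exact absurd rfl hij | skip
    · rfl
    · exact add_comm _ _
  have hprod : (g : Matrix (Fin 2) (Fin 2) ℤ) i i * (h : Matrix (Fin 2) (Fin 2) ℤ) i j = 0 ∧
      (g : Matrix (Fin 2) (Fin 2) ℤ) i j * (h : Matrix (Fin 2) (Fin 2) ℤ) j j = 0 := by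
    rcases hg with hg | hg <;> rcases hh with hh | hh
    · exact (add_eq_zero_iff_of_nonneg (mul_nonneg (hg _ _) (hh _ _))
        (mul_nonneg (hg _ _) (hh _ _))).1 hsum
    · have h1 := mul_nonpos_of_nonneg_of_nonpos (hg i i) (hh i j)
      have h2 := mul_nonpos_of_nonneg_of_nonpos (hg i j) (hh j j)
      omega
    · have h1 := mul_nonpos_of_nonpos_of_nonneg (hg i i) (hh i j)
      have h2 := mul_nonpos_of_nonpos_of_nonneg (hg i j) (hh j j)
      omega
    · exact (add_eq_zero_iff_of_nonneg (mul_nonneg_of_nonpos_of_nonpos (hg _ _) (hh _ _))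
        (mul_nonneg_of_nonpos_of_nonpos (hg _ _) (hh _ _))).1 hsum
  exact ⟨(mul_eq_zero.1 hprod.2).resolve_right hh', (mul_eq_zero.1 hprod.1).resolve_left hg'⟩

lemma hyperbolic (hg : Semipos g) (h01 : (g : Matrix (Fin 2) (Fin 2) ℤ) 0 1 ≠ 0)
    (h10 : (g : Matrix (Fin 2) (Fin 2) ℤ) 1 0 ≠ 0) : Hyperbolic g := by
  have hdet := g.det_coe
  rw [Matrix.det_fin_two] at hdet
  have h1 := hg.mul_off_diag_nonneg
  have h2 : 0 < (g : Matrix (Fin 2) (Fin 2) ℤ) 0 1 * (g : Matrix (Fin 2) (Fin 2) ℤ) 1 0 :=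
    lt_of_le_of_ne h1 (mul_ne_zero h01 h10).symm
  rw [Hyperbolic, Matrix.trace_fin_two, lt_abs]
  have hsq : 4 < ((g : Matrix (Fin 2) (Fin 2) ℤ) 0 0 + (g : Matrix (Fin 2) (Fin 2) ℤ) 1 1) ^ 2 := by
    nlinarith [sq_nonneg ((g : Matrix (Fin 2) (Fin 2) ℤ) 0 0 - (g : Matrix (Fin 2) (Fin 2) ℤ) 1 1)]
  by_contra! hc
  nlinarith [hc.1, hc.2]

end Semipos

/-- The columns are integer representatives of the endpoints of `arc p`. -/
def coneM : Gen → SL2Z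
  | .a => ⟨!![1, 2; 0, 1], by decide⟩
  | .b => ⟨!![0, -1; 1, 1], by decide⟩
  | .c => ⟨!![1, 1; 1, 2], by decide⟩
  | .a' => ⟨!![-1, -1; 1, 0], by decide⟩
  | .b' => ⟨!![1, 0; 2, 1], by decide⟩
  | .c' => ⟨!![2, 1; 1, 1], by decide⟩

/-- The transition matrix between the cones of consecutive letters. -/
def coneStep (p q : Gen) : SL2Z := (coneM p)⁻¹ * genM p * coneM q

/-- The letters `a, b, c`. -/
def IsUnbarred (p : Gen) : Prop := p = .a ∨ p = .b ∨ p = .c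

lemma semipos_coneStep {p q : Gen} (h : ¬ BadPair p q) : Semipos (coneStep p q) := by
  rw [badPair_iff] at h
  cases p <;> cases q <;> first
    | exact absurd rfl h
    | (left; intro i j; fin_cases i <;> fin_cases j <;> decide)
    | (right; intro i j; fin_cases i <;> fin_cases j <;> decide)

lemma coneStep_one_zero {p q : Gen} (h : ¬ BadPair p q)
    (h0 : (coneStep p q : Matrix (Fin 2) (Fin 2) ℤ) 1 0 = 0) :
    IsUnbarred q ∧ (IsUnbarred p → q = p) := by
  rw [badPair_iff] at h
  cases p <;> cases q <;> first
    | exact absurd rfl h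
    | (exfalso; revert h0; decide)
    | simp [IsUnbarred]

lemma coneStep_zero_one {p q : Gen} (h : ¬ BadPair p q)
    (h0 : (coneStep p q : Matrix (Fin 2) (Fin 2) ℤ) 0 1 = 0) :
    ¬ IsUnbarred q ∧ (¬ IsUnbarred p → q = p) := by
  rw [badPair_iff] at h
  cases p <;> cases q <;> first
    | exact absurd rfl h
    | (exfalso; revert h0; decide)
    | simp [IsUnbarred]

namespace IsLine

variable {q : ℤ → SL2Z} {H : ℤ → Gen}

lemma semipos (hq : IsLine q H) (m : ℕ) :
    Semipos ((coneM (H 0))⁻¹ * ((q 0)⁻¹ * q m) * coneM (H m)) ∧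
    ∀ i j, i ≠ j → (((coneM (H 0))⁻¹ * ((q 0)⁻¹ * q m) * coneM (H m) : SL2Z) :
      Matrix (Fin 2) (Fin 2) ℤ) i j = 0 →
      ∀ t < m, (coneStep (H t) (H (t + 1)) : Matrix (Fin 2) (Fin 2) ℤ) i j = 0 := by
  induction m with
  | zero =>
    refine ⟨?_, fun i j _ _ t ht => absurd ht (Nat.not_lt_zero t)⟩
    rw [Nat.cast_zero, inv_mul_cancel, mul_one, inv_mul_cancel]
    left
    intro i j
    fin_cases i <;> fin_cases j <;> decide
  | succ m ih =>
    have heq : (coneM (H 0))⁻¹ * ((q 0)⁻¹ * q (m + 1 : ℕ)) * coneM (H (m + 1 : ℕ)) =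
        ((coneM (H 0))⁻¹ * ((q 0)⁻¹ * q m) * coneM (H m)) * coneStep (H m) (H (m + 1)) := by
      rw [Nat.cast_succ, hq.step, coneStep]
      group
    rw [heq]
    refine ⟨ih.1.mul (semipos_coneStep (hq.not_bad m)), fun i j hij h0 t ht => ?_⟩
    have h := ih.1.off_diag_eq_zero (semipos_coneStep (hq.not_bad m)) hij h0
    rcases Nat.lt_succ_iff_lt_or_eq.1 ht with ht | rfl
    · exact ih.2 i j hij h.1 t ht
    · exact h.2

/-- The translation of a periodic nonconstant line is hyperbolic. -/
lemma hyperbolic_of_periodic (hq : IsLine q H) {n : ℕ} (hn : 0 < n) (hper : ∀ t, H (t + n) = H t)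
    (hne : ∃ t < n, H t ≠ H 0) : Hyperbolic ((q 0)⁻¹ * q n) := by
  have hn0 : H n = H 0 := by simpa using hper 0
  have hs := hq.semipos n
  rw [hn0] at hs
  have hconst : (∀ t < n, H (t + 1) = H t) → False := by
    intro h
    obtain ⟨t, ht, hne⟩ := hne
    apply hne
    clear hne
    induction t with
    | zero => rfl
    | succ t ih => rw [Nat.cast_succ, h t (by omega), ih (by omega)]
  have hpred : ∀ t < n, ∃ s < n, H (s + 1) = H t := by
    intro t ht
    cases t with
    | zero => exact ⟨n - 1, by omega, by rw [Nat.cast_sub hn]; simpa using hn0⟩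
    | succ t => exact ⟨t, by omega, by simp⟩
  have key : Hyperbolic ((coneM (H 0))⁻¹ * ((q 0)⁻¹ * q n) * coneM (H 0)) := by
    refine hs.1.hyperbolic (fun h0 => ?_) (fun h0 => ?_)
    · have hz := hs.2 _ _ (by decide) h0
      refine hconst fun t ht => (coneStep_zero_one (hq.not_bad t) (hz t ht)).2 ?_
      obtain ⟨s, hs', he⟩ := hpred t ht
      rw [← he]
      exact (coneStep_zero_one (hq.not_bad s) (hz s hs')).1
    · have hz := hs.2 _ _ (by decide) h0
      refine hconst fun t ht => (coneStep_one_zero (hq.not_bad t) (hz t ht)).2 ?_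
      obtain ⟨s, hs', he⟩ := hpred t ht
      rw [← he]
      exact (coneStep_one_zero (hq.not_bad s) (hz s hs')).1
  have := trace_conj ((q 0)⁻¹ * q n) (coneM (H 0))⁻¹
  rw [inv_inv] at this
  rwa [Hyperbolic, this] at key

end IsLine

lemma hyperbolic_conj {g : SL2Z} (h : SL2Z) : Hyperbolic (h * g * h⁻¹) ↔ Hyperbolic g := by
  rw [Hyperbolic, Hyperbolic, trace_conj]

lemma hyperbolic_conj' {g : SL2Z} (h : SL2Z) : Hyperbolic (h⁻¹ * g * h) ↔ Hyperbolic g := by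
  simpa using hyperbolic_conj (g := g) h⁻¹

lemma Hyperbolic.exists_irrational {g : SL2Z} (hg : Hyperbolic g) {p : OnePoint ℝ}
    (hp : p ∈ fixedSet g) : ∃ x : ℝ, Irrational x ∧ p = x := by
  obtain ⟨x, y, -, hx, hy, h, -⟩ := hg.exists_fixedSet
  rw [h] at hp
  rcases hp with rfl | rfl
  exacts [⟨x, hx, rfl⟩, ⟨y, hy, rfl⟩]

lemma genM_injective : Function.Injective genM := by
  intro p q h
  have := phi6_injOn (u := [p]) (u' := [q]) (List.isChain_singleton _) (List.isChain_singleton _)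
    (by simpa [phi6] using h)
  simpa using this

/-- A line on which `v` acts by translation by `n` steps. -/
structure IsAxis (v : SL2Z) (n : ℕ) (q : ℤ → SL2Z) (H : ℤ → Gen) : Prop extends IsLine q H where
  pos : 0 < n
  translate : ∀ t, q (t + n) = v * q t

namespace IsAxis

variable {v : SL2Z} {n : ℕ} {q : ℤ → SL2Z} {H : ℤ → Gen}

lemma periodic (hq : IsAxis v n q H) (t : ℤ) : H (t + n) = H t := by
  have h1 := hq.translate (t + 1)
  rw [hq.step, add_right_comm, hq.step, hq.translate, mul_assoc, mul_right_inj, mul_right_inj] at h1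
  exact genM_injective h1

lemma conj (hq : IsAxis v n q H) (g : SL2Z) (k : ℤ) :
    IsAxis (g * v * g⁻¹) n (fun t => g * q (t + k)) (fun t => H (t + k)) where
  toIsLine := (hq.toIsLine.shift k).smul g
  pos := hq.pos
  translate t := by
    rw [add_right_comm, hq.translate]
    group

lemma reverse (hq : IsAxis v n q H) :
    IsAxis v⁻¹ n (fun t => q (-t)) (fun t => genInv (H (-t - 1))) where
  toIsLine := hq.toIsLine.reverse
  pos := hq.pos
  translate t := by
    have := hq.translate (-(t + n))
    rw [eq_inv_mul_iff_mul_eq, ← this]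
    congr 1
    ring

lemma end_or_side (hq : IsAxis v n q H) (h0 : q 0 = 1) {x : ℝ} {s : Gen} (hs : x ∈ arc s)
    (hx : (x : OnePoint ℝ) ∈ fixedSet v) : s = H 0 ∨ side s = side (genInv (H (-1))) := by
  have hv : v = phi6 (IsLine.word H n) := by
    have h1 := hq.translate 0
    rwa [zero_add, hq.eq_mul_phi6, h0, one_mul, mul_one, eq_comm] at h1
  obtain ⟨m, rfl⟩ : ∃ m, n = m + 1 := ⟨n - 1, by have := hq.pos; omega⟩
  have hlast : H (-1) = H m := by
    rw [← hq.periodic (-1)]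
    congr 1
    push_cast
    ring
  by_cases hb : BadPair (H m) s
  · right
    rwa [hlast, ← badPair_iff]
  · left
    have hred : Reduced (IsLine.word H (m + 1) ++ [s]) := by
      rw [Reduced, List.isChain_append]
      refine ⟨hq.reduced_word _, List.isChain_singleton _, ?_⟩
      intro a ha b hb'
      simp only [IsLine.word, List.range_succ, List.map_append, List.map_cons, List.map_nil,
        List.getLast?_concat, Option.mem_def, Option.some.injEq, List.head?_cons] at ha hb'
      rwa [← ha, ← hb']
    obtain ⟨u, hu⟩ : ∃ u, IsLine.word H (m + 1) = H 0 :: u :=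
      ⟨_, by rw [IsLine.word, List.range_succ_eq_map, List.map_cons]; rfl⟩
    rw [hu] at hv hred
    obtain ⟨y, hy, hxy⟩ := mobius_phi6_mem hs u _ hred
    rw [← hv, show mobius v x = x from hx, OnePoint.coe_eq_coe] at hxy
    subst hxy
    exact arc_disjoint hs hy

/-- The fixed points of the translation lie in the arcs of the two letters leaving a vertex along
its axis. -/
lemma end_of_eq_one (hq : IsAxis v n q H) (h0 : q 0 = 1) {x : ℝ} {s : Gen} (hs : x ∈ arc s)
    (hx : (x : OnePoint ℝ) ∈ fixedSet v) : s = H 0 ∨ s = genInv (H (-1)) := by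
  rcases hq.end_or_side h0 hs hx with h | h
  · exact Or.inl h
  rcases hq.reverse.end_or_side h0 hs (mobius_inv_mem_fixedSet hx) with h' | h'
  · right
    simpa using h'
  · exfalso
    have := hq.not_bad (-1)
    rw [badPair_iff] at this
    apply this
    simp only [neg_neg, sub_self, genInv_genInv] at h'
    rw [neg_add_cancel, ← h, h']

lemma exists_end (hq : IsAxis v n q H) (hv : Hyperbolic v) (k : ℤ) {p : OnePoint ℝ}
    (hp : p ∈ fixedSet ((q k)⁻¹ * v * q k)) :
    ∃ (s : Gen) (k' : ℤ) (x : ℝ), p = x ∧ x ∈ arc s ∧ q k' = q k * genM s := by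
  obtain ⟨x, hx, rfl⟩ := ((hyperbolic_conj' (q k)).2 hv).exists_irrational hp
  obtain ⟨s, hs⟩ := exists_mem_arc hx
  have hc := hq.conj (q k)⁻¹ k
  rw [inv_inv] at hc
  have h := hc.end_of_eq_one (by simp) hs hp
  rw [zero_add, neg_add_eq_sub] at h
  rcases h with rfl | rfl
  · exact ⟨_, k + 1, x, rfl, hs, hq.step k⟩
  · refine ⟨_, k - 1, x, rfl, hs, ?_⟩
    have := hq.step (k - 1)
    rw [sub_add_cancel] at this
    rw [this, genM_genInv, mul_inv_cancel_right]

/-- If `h` moves the axis of `v` off itself completely, then the axis and its translate are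
unlinked. -/
lemma exists_common_vertex (hq : IsAxis v n q H) (hv : Hyperbolic v) (hmem : ∀ k, q k ∈ Gamma)
    {h : SL2Z} (hh : h ∈ Gamma) (hT : traceComm v (h * v * h⁻¹) ≤ 2) :
    ∃ k l, q k = h * q l := by
  have hex : ∃ N, ∃ k l u, u.length = N ∧ phi6 u = (q k)⁻¹ * h * q l := by
    obtain ⟨u, hu⟩ := exists_phi6_eq (mul_mem (mul_mem (inv_mem (hmem 0)) hh) (hmem 0))
    exact ⟨_, 0, 0, u, rfl, hu⟩
  obtain ⟨k, l, u, hlen, hu⟩ := Nat.find_spec hex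
  have hmin : ∀ k' l' u', phi6 u' = (q k')⁻¹ * h * q l' → u.length ≤ u'.length := by
    intro k' l' u' hu'
    rw [hlen]
    exact Nat.find_min' hex ⟨k', l', u', rfl, hu'⟩
  clear hlen hex
  have hmin_red : ∀ k' l' u', phi6 u' = (q k')⁻¹ * h * q l' → u'.length = u.length →
      Reduced u' := by
    intro k' l' u' hu' hl
    by_contra hr
    obtain ⟨u'', hlt, he⟩ := exists_shorter hr
    have := hmin k' l' u'' (he.trans hu')
    omega
  have hhead : ∀ l' z r, phi6 (z :: r) = (q k)⁻¹ * h * q l' → (z :: r).length = u.length →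
      ∀ k', q k' ≠ q k * genM z := by
    intro l' z r hu' hl k' hk'
    rw [phi6_cons] at hu'
    have := hmin k' l' r (by
      rw [hk', mul_inv_rev, mul_assoc, mul_assoc, ← mul_assoc _ h, ← hu', inv_mul_cancel_left])
    rw [← hl, List.length_cons] at this
    omega
  rcases List.eq_nil_or_concat u with rfl | ⟨u₁, c, rfl⟩
  · refine ⟨k, l, ?_⟩
    rw [phi6_nil, mul_assoc, eq_inv_mul_iff_mul_eq, mul_one] at hu
    exact hu
  exfalso
  rw [List.concat_eq_append] at *
  set g := phi6 (u₁ ++ [c]) with hg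
  obtain ⟨z₀, r₀, hz₀⟩ : ∃ z₀ r₀, u₁ ++ [c] = z₀ :: r₀ := List.exists_cons_of_ne_nil (by simp)
  have hred := hmin_red k l _ hu rfl
  have hmap : ∀ e l', q l' = q l * genM e → ∀ x ∈ arc e, ∃ z, side z = side z₀ ∧
      (∀ k', q k' ≠ q k * genM z) ∧ mobius g x ∈ ((↑) '' arc z : Set (OnePoint ℝ)) := by
    intro e l' hl' x hx
    have hge : g * genM e = (q k)⁻¹ * h * q l' := by rw [hu, hl', mul_assoc]
    by_cases hb : BadPair c e
    · rcases hb.cases with rfl | ⟨m, hm, hcm, hmap⟩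
      · exfalso
        rw [hg, phi6_append, phi6_cons, phi6_nil, mul_one, genM_genInv, mul_inv_cancel_right] at hge
        have := hmin k l' u₁ hge
        simp at this
      · have hU : phi6 (u₁ ++ [m]) = (q k)⁻¹ * h * q l' := by
          rw [← hge, hg, phi6_append, phi6_append, mul_assoc, phi6_cons, phi6_cons, phi6_nil,
            mul_one, mul_one, hcm]
        have hUred := hmin_red k l' _ hU (by simp)
        obtain ⟨y, hy, hy'⟩ := hmap x hx
        have hgx : mobius g x = mobius (phi6 u₁) y := by
          rw [hy', hg, phi6_append, mobius_mul, phi6_cons, phi6_nil, mul_one]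
        cases u₁ with
        | nil =>
          simp only [List.nil_append, List.cons.injEq] at hz₀
          refine ⟨m, by rw [hm, hz₀.1], hhead l' m [] hU (by simp), ?_⟩
          rw [hgx, phi6_nil, mobius_one]
          exact ⟨y, hy, rfl⟩
        | cons z r =>
          simp only [List.cons_append, List.cons.injEq] at hz₀
          refine ⟨z, by rw [hz₀.1], hhead l' z (r ++ [m]) hU (by simp), ?_⟩
          rw [hgx]
          exact mobius_phi6_mem hy r z hUred
    · refine ⟨z₀, rfl, hhead l z₀ r₀ (by rw [← hz₀, ← hg, hu]) (by rw [hz₀]), ?_⟩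
      rw [hg, hz₀]
      refine mobius_phi6_mem hx r₀ z₀ ?_
      rw [← List.cons_append, ← hz₀, Reduced, List.isChain_append]
      refine ⟨hred, List.isChain_singleton _, ?_⟩
      intro a ha b hb'
      simp only [List.getLast?_concat, Option.mem_def, Option.some.injEq, List.head?_cons] at ha hb'
      rwa [← ha, ← hb']
  have hvl := (hyperbolic_conj' (q l)).2 hv
  have h2 := two_lt_traceComm ((hyperbolic_conj' (q k)).2 hv) ((hyperbolic_conj g).2 hvl) ?_
  · have hconj := traceComm_conj v (h * v * h⁻¹) (q k)⁻¹
    rw [inv_inv, show (q k)⁻¹ * (h * v * h⁻¹) * q k = g * ((q l)⁻¹ * v * q l) * g⁻¹ by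
      rw [hu]; group] at hconj
    rw [hconj] at h2
    exact absurd hT (not_le.2 h2)
  · have hy : ∀ y : ℝ, (y : OnePoint ℝ) ∈ fixedSet (g * ((q l)⁻¹ * v * q l) * g⁻¹) →
        ∃ z, side z = side z₀ ∧ (∀ k', q k' ≠ q k * genM z) ∧ y ∈ arc z := by
      intro y hy
      have hy₁ := mobius_mem_fixedSet_conj (h := g⁻¹) hy
      rw [show g⁻¹ * (g * ((q l)⁻¹ * v * q l) * g⁻¹) * g⁻¹⁻¹ = (q l)⁻¹ * v * q l by group] at hy₁
      obtain ⟨e, l', x, hx, hxe, hl'⟩ := hq.exists_end hv l hy₁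
      obtain ⟨z, h1, h2, y', hy', h3⟩ := hmap e l' hl' x hxe
      rw [← hx, ← mobius_mul, mul_inv_cancel, mobius_one, OnePoint.coe_eq_coe] at h3
      subst h3
      exact ⟨z, h1, h2, hy'⟩
    intro x y y' hxf hyf hyf'
    obtain ⟨s, k', x', hxx, hs, hk'⟩ := hq.exists_end hv k hxf
    rw [OnePoint.coe_eq_coe] at hxx
    subst hxx
    obtain ⟨z, hz, hzk, hyz⟩ := hy y hyf
    obtain ⟨z', hz', hzk', hyz'⟩ := hy y' hyf'
    exact arc_side_separated (hz.trans hz'.symm) (fun h => hzk k' (h ▸ hk'))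
      (fun h => hzk' k' (h ▸ hk')) hs hyz hyz'

end IsAxis

namespace IsLine

variable {q q' : ℤ → SL2Z} {H H' : ℤ → Gen}

lemma sync_of_le (hq : IsLine q H) (hq' : IsLine q' H') {k k' l l' : ℤ} (h : q k = q' l)
    (h' : q k' = q' l') (hk : k ≤ k') (hl : l ≤ l') :
    k' - k = l' - l ∧ ∀ t : ℕ, t < k' - k → H (k + t) = H' (l + t) ∧ q (k + t) = q' (l + t) := by
  obtain ⟨m, rfl⟩ := Int.le.dest hk
  obtain ⟨m', rfl⟩ := Int.le.dest hl
  have hs := (hq.shift k).sync (hq'.shift l) (by simpa using h) (m := m) (m' := m')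
    (by simpa [add_comm] using h')
  refine ⟨by simp [hs.1], fun t ht => ?_⟩
  have hH : ∀ t : ℕ, t < m → H (k + t) = H' (l + t) := fun t ht => by
    rw [add_comm k, add_comm l]
    exact hs.2 t ht
  rw [add_sub_cancel_left, Nat.cast_lt] at ht
  refine ⟨hH t ht, ?_⟩
  induction t with
  | zero => simpa using h
  | succ t ih =>
    rw [Nat.cast_succ, ← add_assoc, ← add_assoc, hq.step, hq'.step, ih (by omega), hH t (by omega)]

/-- Two lines meet in a connected set. -/
lemma exists_eq_of_between (hq : IsLine q H) (hq' : IsLine q' H') {k k' l l' t : ℤ} (h : q k = q' l)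
    (h' : q k' = q' l') (hk : k ≤ t) (hk' : t ≤ k') : ∃ s, q t = q' s := by
  rcases hk'.eq_or_lt with rfl | hk'
  · exact ⟨l', h'⟩
  obtain ⟨m, rfl⟩ := Int.le.dest hk
  rcases le_total l l' with hl | hl
  · exact ⟨l + m, ((hq.sync_of_le hq' h h' (by omega) hl).2 m (by omega)).2⟩
  · exact ⟨-(-l + m), ((hq.sync_of_le hq'.reverse (l := -l) (l' := -l') (by simpa using h)
      (by simpa using h') (by omega) (by omega)).2 m (by omega)).2⟩

lemma eq_of_adjacent (hq : IsLine q H) (hq' : IsLine q' H') {k l l' : ℤ} (h : q k = q' l)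
    (h' : q (k + 1) = q' l') : H k = H' l ∨ H k = genInv (H' (l - 1)) := by
  rcases le_total l l' with hl | hl
  · left
    simpa using ((hq.sync_of_le hq' h h' (by omega) hl).2 0 (by simp)).1
  · right
    simpa using ((hq.sync_of_le hq'.reverse (l := -l) (l' := -l') (by simpa using h)
      (by simpa using h') (by omega) (by omega)).2 0 (by simp)).1

lemma pred (hq : IsLine q H) (k : ℤ) : q (k - 1) = q k * genM (genInv (H (k - 1))) := by
  have h := hq.step (k - 1)
  rw [sub_add_cancel] at h
  rw [h, genM_genInv, mul_inv_cancel_right]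

lemma exists_succ_eq_iff (hq : IsLine q H) (hq' : IsLine q' H') {k l : ℤ} (h : q k = q' l) :
    (∃ l', q (k + 1) = q' l') ↔ H k = H' l ∨ H k = genInv (H' (l - 1)) := by
  refine ⟨fun ⟨l', h'⟩ => hq.eq_of_adjacent hq' h h', ?_⟩
  rintro (hH | hH)
  · exact ⟨l + 1, by rw [hq.step, hq'.step, h, hH]⟩
  · exact ⟨l - 1, by rw [hq.step, hq'.pred, h, hH]⟩

lemma exists_pred_eq_iff (hq : IsLine q H) (hq' : IsLine q' H') {k l : ℤ} (h : q k = q' l) :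
    (∃ l', q (k - 1) = q' l') ↔
      genInv (H (k - 1)) = H' l ∨ genInv (H (k - 1)) = genInv (H' (l - 1)) := by
  have := hq.reverse.exists_succ_eq_iff hq' (k := -k) (l := l) (by simpa using h)
  simpa [sub_eq_add_neg, add_comm] using this

lemma ne_genInv_pred (hq : IsLine q H) (k : ℤ) : H k ≠ genInv (H (k - 1)) := by
  intro h
  have := hq.not_bad (k - 1)
  rw [sub_add_cancel, badPair_iff, h] at this
  exact this rfl

end IsLine

lemma card_quadruple {α : Type*} [DecidableEq α] {p q r s : α} (hpq : p ≠ q) (hrs : r ≠ s) :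
    (({p, q, r, s} : Finset α).card : ℚ) - 2 =
      2 - (if p = r ∨ p = s then 1 else 0) - (if q = r ∨ q = s then 1 else 0) := by
  have h2 : ({r, s} : Finset α).card = 2 := Finset.card_pair hrs
  rw [Finset.card_insert_eq_ite, Finset.card_insert_eq_ite, h2]
  simp only [Finset.mem_insert, Finset.mem_singleton, hpq, false_or]
  split_ifs <;> norm_num

lemma sum_Icc_boundary {i j : ℤ} (hij : i ≤ j) :
    ∑ k ∈ Finset.Icc i j, ((2 : ℚ) - (if k + 1 ∈ Finset.Icc i j then 1 else 0) -
      (if k - 1 ∈ Finset.Icc i j then 1 else 0)) = 2 := by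
  obtain ⟨m, rfl⟩ := Int.le.dest hij
  have h1 : (Finset.Icc i (i + m)).filter (fun k => k + 1 ∈ Finset.Icc i (i + m)) =
      Finset.Ico i (i + m) := by
    ext k
    simp only [Finset.mem_filter, Finset.mem_Icc, Finset.mem_Ico]
    omega
  have h2 : (Finset.Icc i (i + m)).filter (fun k => k - 1 ∈ Finset.Icc i (i + m)) =
      Finset.Ioc i (i + m) := by
    ext k
    simp only [Finset.mem_filter, Finset.mem_Icc, Finset.mem_Ioc]
    omega
  rw [Finset.sum_sub_distrib, Finset.sum_sub_distrib, Finset.sum_boole, Finset.sum_boole, h1, h2]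
  simp only [Finset.sum_const, Int.card_Icc, Int.card_Ico, Int.card_Ioc, nsmul_eq_mul]
  rw [show (i + m + 1 - i).toNat = m + 1 by omega, show (i + m - i).toNat = m by omega]
  push_cast
  ring

lemma exists_eq_Icc {K : Set ℤ} (hfin : K.Finite) (hne : K.Nonempty)
    (hconv : ∀ i ∈ K, ∀ j ∈ K, ∀ t, i ≤ t → t ≤ j → t ∈ K) : ∃ i j, i ≤ j ∧ K = Set.Icc i j := by
  obtain ⟨i, hi, himin⟩ := hfin.exists_minimalFor id K hne
  obtain ⟨j, hj, hjmax⟩ := hfin.exists_maximalFor id K hne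
  have hmin : ∀ k ∈ K, i ≤ k := fun k hk => (le_total i k).elim id fun h => himin hk h
  have hmax : ∀ k ∈ K, k ≤ j := fun k hk => (le_total k j).elim id fun h => hjmax hk h
  exact ⟨i, j, hmin j hj, Set.Subset.antisymm (fun k hk => ⟨hmin k hk, hmax k hk⟩)
    fun k hk => hconv i hi j hj k hk.1 hk.2⟩

namespace IsAxis

variable {v : SL2Z} {n : ℕ} {q : ℤ → SL2Z} {H : ℤ → Gen}

lemma translate_zpow (hq : IsAxis v n q H) (m t : ℤ) : q (t + m * n) = v ^ m * q t := by
  induction m using Int.induction_on with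
  | zero => simp
  | succ m ih =>
    rw [add_mul, one_mul, ← add_assoc, hq.translate, ih, zpow_add_one, ← mul_assoc,
      (Commute.zpow_self v m).eq]
  | pred m ih =>
    have := hq.translate (t + (-m - 1) * n)
    rw [show t + (-m - 1) * n + n = t + -m * n by ring, ih] at this
    rw [zpow_sub_one, (Commute.zpow_self v (-m : ℤ)).inv_right.eq, mul_assoc, this,
      inv_mul_cancel_left]

lemma zpow_eq_one (hq : IsAxis v n q H) {m : ℤ} (h : v ^ m = 1) : m = 0 := by
  have := hq.translate_zpow m 0
  rw [h, one_mul] at this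
  have h0 := hq.injective this
  rw [zero_add] at h0
  exact (mul_eq_zero.1 h0).resolve_right (by exact_mod_cast hq.pos.ne')

lemma periodic_mul (hq : IsAxis v n q H) (m t : ℤ) : H (t + m * n) = H t := by
  have h1 := hq.translate_zpow m (t + 1)
  rw [hq.step, add_right_comm, hq.step, hq.translate_zpow, mul_assoc, mul_right_inj,
    mul_right_inj] at h1
  exact genM_injective h1

lemma zpow_eq_zero_of_conj (hq : IsAxis v n q H) {h : SL2Z} (hT : traceComm v (h * v * h⁻¹) ≠ 2)
    {i j : ℤ} (he : v ^ i * h = h * v ^ j) : i = 0 := by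
  by_contra hi
  apply hT
  apply traceComm_of_commute
  refine commute_of_commute_of_ne (t := v ^ i) (Commute.self_zpow v i) ?_ ?_
  · have : v ^ i = h * v ^ j * h⁻¹ := by rw [← he, mul_inv_cancel_right]
    rw [this]
    have hc : Commute v (v ^ j) := Commute.self_zpow v j
    rw [Commute, SemiconjBy]
    calc h * v * h⁻¹ * (h * v ^ j * h⁻¹) = h * (v * v ^ j) * h⁻¹ := by group
      _ = h * (v ^ j * v) * h⁻¹ := by rw [hc.eq]
      _ = h * v ^ j * h⁻¹ * (h * v * h⁻¹) := by group
  · intro h1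
    rw [← zpow_natCast, ← zpow_mul] at h1
    have := hq.zpow_eq_one h1
    simp at this
    exact hi this

lemma emod_injOn (hq : IsAxis v n q H) {h : SL2Z} (hT : traceComm v (h * v * h⁻¹) ≠ 2)
    {k l k' l' : ℤ} (hk : q k = h * q l) (hk' : q k' = h * q l') (hkk : k % n = k' % n)
    (hll : l % n = l' % n) : k = k' := by
  obtain ⟨i, hi⟩ := Int.dvd_of_emod_eq_zero (Int.emod_eq_emod_iff_emod_sub_eq_zero.1 hkk.symm)
  obtain ⟨j, hj⟩ := Int.dvd_of_emod_eq_zero (Int.emod_eq_emod_iff_emod_sub_eq_zero.1 hll.symm)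
  obtain rfl : k' = k + i * n := by linarith
  obtain rfl : l' = l + j * n := by linarith
  rw [hq.translate_zpow, hq.translate_zpow, hk, ← mul_assoc, ← mul_assoc, mul_left_inj] at hk'
  rw [hq.zpow_eq_zero_of_conj hT hk', zero_mul, add_zero]

lemma finite_overlap (hq : IsAxis v n q H) {h : SL2Z} (hT : traceComm v (h * v * h⁻¹) ≠ 2) :
    {k | ∃ l, q k = h * q l}.Finite := by
  choose! L hL using fun k (hk : ∃ l, q k = h * q l) => hk
  have hn : (0 : ℤ) < n := by exact_mod_cast hq.pos
  refine Set.Finite.of_injOn (f := fun k => (k % (n : ℤ), L k % (n : ℤ)))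
    (t := Set.Ico 0 (n : ℤ) ×ˢ Set.Ico 0 (n : ℤ)) ?_ ?_
    ((Set.finite_Ico _ _).prod (Set.finite_Ico _ _))
  · intro k _
    exact ⟨⟨Int.emod_nonneg _ hn.ne', Int.emod_lt_of_pos _ hn⟩,
      ⟨Int.emod_nonneg _ hn.ne', Int.emod_lt_of_pos _ hn⟩⟩
  · intro k hk k' hk' he
    rw [Prod.mk.injEq] at he
    exact hq.emod_injOn hT (hL k hk) (hL k' hk') he.1 he.2

/-- The local contributions along the overlap of the axis with a linked translate add up to two. -/
lemma sum_overlap (hq : IsAxis v n q H) (hv : Hyperbolic v) (hmem : ∀ k, q k ∈ Gamma) {h : SL2Z}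
    (hh : h ∈ Gamma) (hT : traceComm v (h * v * h⁻¹) < 2) {K : Finset ℤ}
    (hK : ∀ k, k ∈ K ↔ ∃ l, q k = h * q l) {L : ℤ → ℤ} (hL : ∀ k ∈ K, q k = h * q (L k)) :
    ∑ k ∈ K, ((({H k, genInv (H (k - 1)), H (L k), genInv (H (L k - 1))} :
      Finset Gen).card : ℚ) - 2) = 2 := by
  have hq' := hq.toIsLine.smul h
  obtain ⟨i, j, hij, hIcc⟩ := exists_eq_Icc (K := {k | ∃ l, q k = h * q l})
    (hq.finite_overlap hT.ne) (hq.exists_common_vertex hv hmem hh hT.le)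
    (fun i ⟨_, hi⟩ j ⟨_, hj⟩ t h1 h2 => hq.exists_eq_of_between hq' hi hj h1 h2)
  obtain rfl : K = Finset.Icc i j := by
    ext k
    rw [hK, Finset.mem_Icc, ← Set.mem_Icc, ← hIcc]
    rfl
  refine (Finset.sum_congr rfl fun k hk => ?_).trans (sum_Icc_boundary hij)
  rw [card_quadruple (hq.ne_genInv_pred k) (hq.ne_genInv_pred (L k))]
  congr 2
  · congr 1
    rw [hK, hq.exists_succ_eq_iff hq' (hL k hk)]
  · rw [hK, hq.exists_pred_eq_iff hq' (hL k hk)]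

end IsAxis

lemma goodConj_iff {v h : Gamma} (hv : Hyperbolic (v : SL2Z)) :
    GoodConj v h ↔ traceComm (v : SL2Z) ((h : SL2Z) * v * (h : SL2Z)⁻¹) < 2 := by
  have hc : Hyperbolic ((h * v * h⁻¹ : Gamma) : SL2Z) := (hyperbolic_conj (h : SL2Z)).2 hv
  rw [GoodConj, linked_iff hv hc]
  exact ⟨fun H => H.2.2, fun H => ⟨hv, hc, H⟩⟩

/-- The double coset relation defining `sTwo`. -/
def DoubleCosetRel (v : Gamma) (h h' : {h : Gamma // GoodConj v h}) : Prop :=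
  ∃ m k : ℤ, (h' : Gamma) = v ^ m * (h : Gamma) * v ^ k

lemma doubleCosetRel_equivalence (v : Gamma) : Equivalence (DoubleCosetRel v) where
  refl h := ⟨0, 0, by simp⟩
  symm := by
    rintro h h' ⟨m, k, hmk⟩
    refine ⟨-m, -k, ?_⟩
    rw [hmk]
    group
  trans := by
    rintro h h' h'' ⟨m, k, hmk⟩ ⟨m', k', hmk'⟩
    refine ⟨m' + m, k + k', ?_⟩
    rw [hmk', hmk]
    group

lemma sTwo_eq (v : Gamma) : sTwo v = Nat.card (Quot (DoubleCosetRel v)) := rfl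

namespace IsAxis

variable {v : Gamma} {n : ℕ} {q : ℤ → SL2Z} {H : ℤ → Gen}

/-- The vertices `i, j` of a fundamental domain for which the conjugates of `v` based at these
vertices are linked. -/
abbrev LinkedPair (v : Gamma) (n : ℕ) (q : ℤ → SL2Z) (hmem : ∀ k, q k ∈ Gamma) :=
  {x : Fin n × Fin n // GoodConj v (⟨q x.1, hmem _⟩ * ⟨q x.2, hmem _⟩⁻¹)}

/-- The double coset of a linked pair. -/
def toDoubleCoset (hmem : ∀ k, q k ∈ Gamma) (x : LinkedPair v n q hmem) :
    Quot (DoubleCosetRel v) :=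
  Quot.mk _ ⟨_, x.2⟩

/-- The residue of an integer modulo `n`. -/
def residue (hq : IsAxis (v : SL2Z) n q H) (k : ℤ) : Fin n :=
  ⟨(k % n).toNat, by
    have := Int.emod_lt_of_pos k (by exact_mod_cast hq.pos : (0 : ℤ) < n)
    have := hq.pos
    omega⟩

lemma coe_residue (hq : IsAxis (v : SL2Z) n q H) (k : ℤ) :
    (((hq.residue k : Fin n) : ℕ) : ℤ) = k % n := by
  have := Int.emod_nonneg k (by exact_mod_cast hq.pos.ne' : (n : ℤ) ≠ 0)
  simp [residue, this]

lemma apply_eq_residue (hq : IsAxis (v : SL2Z) n q H) (k : ℤ) :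
    q k = (v : SL2Z) ^ (k / n) * q (hq.residue k : ℕ) := by
  rw [← hq.translate_zpow, coe_residue, mul_comm, Int.emod_add_mul_ediv]

lemma letter_residue (hq : IsAxis (v : SL2Z) n q H) (k : ℤ) :
    H (hq.residue k : ℕ) = H k ∧ H ((hq.residue k : ℕ) - 1) = H (k - 1) := by
  have h1 := hq.periodic_mul (k / n) (hq.residue k : ℕ)
  have h2 := hq.periodic_mul (k / n) ((hq.residue k : ℕ) - 1)
  rw [coe_residue, mul_comm, Int.emod_add_mul_ediv] at h1
  rw [coe_residue, mul_comm, sub_add_eq_add_sub, Int.emod_add_mul_ediv] at h2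
  rw [coe_residue]
  exact ⟨h1.symm, h2.symm⟩

lemma rel_residue (hq : IsAxis (v : SL2Z) n q H) (hmem : ∀ k, q k ∈ Gamma) {h : Gamma} {k l : ℤ}
    (hkl : q k = h * q l) : (⟨q (hq.residue k : ℕ), hmem _⟩ * ⟨q (hq.residue l : ℕ), hmem _⟩⁻¹ :
      Gamma) = v ^ (-(k / n)) * h * v ^ (l / n) := by
  ext1
  rw [hq.apply_eq_residue k, hq.apply_eq_residue l] at hkl
  push_cast
  rw [mul_inv_eq_iff_eq_mul, zpow_neg, mul_assoc, mul_assoc, eq_inv_mul_iff_mul_eq, hkl]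

lemma goodConj_of_rel (hv : Hyperbolic (v : SL2Z)) {h h' : Gamma} (hh : GoodConj v h) {m k : ℤ}
    (heq : h' = v ^ m * h * v ^ k) : GoodConj v h' := by
  rw [goodConj_iff hv] at hh ⊢
  rw [← traceComm_conj _ _ ((v : SL2Z) ^ m)] at hh
  convert hh using 2
  · rw [(Commute.zpow_self (v : SL2Z) m).eq, mul_inv_cancel_right]
  · rw [heq]
    push_cast
    have hc : (v : SL2Z) ^ k * v = v * (v : SL2Z) ^ k := (Commute.zpow_self (v : SL2Z) k).eq
    calc (v : SL2Z) ^ m * h * (v : SL2Z) ^ k * v * ((v : SL2Z) ^ m * h * (v : SL2Z) ^ k)⁻¹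
        = (v : SL2Z) ^ m * h * ((v : SL2Z) ^ k * v) * ((v : SL2Z) ^ m * h * (v : SL2Z) ^ k)⁻¹ := by
          group
      _ = _ := by rw [hc]; group

lemma toDoubleCoset_surjective (hq : IsAxis (v : SL2Z) n q H) (hv : Hyperbolic (v : SL2Z))
    (hmem : ∀ k, q k ∈ Gamma) :
    Function.Surjective (toDoubleCoset (v := v) (n := n) hmem) := by
  intro y
  induction y using Quot.ind with
  | mk h =>
    obtain ⟨k, l, hkl⟩ := hq.exists_common_vertex hv hmem h.1.2
      ((goodConj_iff hv).1 h.2).le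
    have hrel := hq.rel_residue hmem hkl
    refine ⟨⟨(hq.residue k, hq.residue l), goodConj_of_rel hv h.2 hrel⟩, ?_⟩
    exact (Quot.sound ⟨_, _, hrel⟩).symm

/-- The contribution of a pair of vertices. -/
def weight (H : ℤ → Gen) (i j : ℤ) : ℚ :=
  (({H i, genInv (H (i - 1)), H j, genInv (H (j - 1))} : Finset Gen).card : ℚ) - 2

lemma sum_fiber (hq : IsAxis (v : SL2Z) n q H) (hv : Hyperbolic (v : SL2Z))
    (hmem : ∀ k, q k ∈ Gamma) (y : Quot (DoubleCosetRel v)) :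
    ∑ x : {x : LinkedPair v n q hmem // toDoubleCoset hmem x = y},
      weight H (x.1.1.1 : ℕ) (x.1.1.2 : ℕ) = 2 := by
  induction y using Quot.ind with
  | mk h =>
    have hT := (goodConj_iff hv).1 h.2
    choose! L hL using fun k (hk : ∃ l, q k = h * q l) => hk
    have hK : ∀ k, k ∈ (hq.finite_overlap hT.ne).toFinset ↔ ∃ l, q k = (h : SL2Z) * q l :=
      fun k => Set.Finite.mem_toFinset _
    rw [← hq.sum_overlap hv hmem h.1.2 hT hK fun k hk => hL k ((hK k).1 hk)]
    symm
    refine Finset.sum_bij (fun k hk => ⟨⟨(hq.residue k, hq.residue (L k)),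
      goodConj_of_rel hv h.2 (hq.rel_residue hmem (hL k ((hK k).1 hk)))⟩,
      (Quot.sound ⟨_, _, hq.rel_residue hmem (hL k ((hK k).1 hk))⟩).symm⟩) ?_ ?_ ?_ ?_
    · intro k hk
      exact Finset.mem_univ _
    · intro k hk k' hk' he
      have he₁ := congrArg (fun x => x.1.1.1) he
      have he₂ := congrArg (fun x => x.1.1.2) he
      dsimp only at he₁ he₂
      refine hq.emod_injOn hT.ne (hL k ((hK k).1 hk)) (hL k' ((hK k').1 hk')) ?_ ?_
      · rw [← hq.coe_residue, ← hq.coe_residue, he₁]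
      · rw [← hq.coe_residue, ← hq.coe_residue, he₂]
    · rintro ⟨⟨⟨i, j⟩, hij⟩, hy⟩ -
      obtain ⟨m, k, hmk⟩ := (Equivalence.quot_mk_eq_iff (doubleCosetRel_equivalence v) _ _).1 hy.symm
      have hmk' := congrArg (Subtype.val : Gamma → SL2Z) hmk
      push_cast at hmk'
      have hvert : q ((i : ℕ) + -m * n) = h * q ((j : ℕ) + k * n) := by
        rw [hq.translate_zpow, hq.translate_zpow, zpow_neg, inv_mul_eq_iff_eq_mul,
          ← mul_assoc, ← mul_assoc, ← hmk', inv_mul_cancel_right]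
      have hmemK := (hK ((i : ℕ) + -m * n)).2 ⟨_, hvert⟩
      have hLeq : L ((i : ℕ) + -m * n) = (j : ℕ) + k * n := by
        have h1 := hL _ ((hK _).1 hmemK)
        rw [hvert, mul_right_inj] at h1
        exact (hq.injective h1).symm
      refine ⟨_, hmemK, ?_⟩
      have hres : ∀ (i : Fin n) (m : ℤ), hq.residue ((i : ℕ) + m * n) = i := by
        intro i m
        have := hq.coe_residue ((i : ℕ) + m * n)
        rw [Int.add_mul_emod_self_right, Int.emod_eq_of_lt (by omega) (by have := i.2; omega)] at this
        exact Fin.ext (by exact_mod_cast this)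
      exact Subtype.ext (Subtype.ext (Prod.ext (hres i _) (by dsimp only; rw [hLeq, hres])))
    · intro k hk
      simp only [weight]
      rw [(hq.letter_residue k).1, (hq.letter_residue k).2, (hq.letter_residue (L k)).1,
        (hq.letter_residue (L k)).2]

lemma linked_iff_goodConj (hv : Hyperbolic (v : SL2Z)) (hmem : ∀ k, q k ∈ Gamma) (i j : ℤ) :
    Linked (fixedSet ((q i)⁻¹ * v * q i)) (fixedSet ((q j)⁻¹ * v * q j)) ↔
      GoodConj v (⟨q i, hmem i⟩ * ⟨q j, hmem j⟩⁻¹) := by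
  rw [linked_iff ((hyperbolic_conj' _).2 hv) ((hyperbolic_conj' _).2 hv), goodConj_iff hv,
    ← traceComm_conj _ _ (q i)]
  have h1 : q i * ((q i)⁻¹ * v * q i) * (q i)⁻¹ = v := by group
  have h2 : q i * ((q j)⁻¹ * v * q j) * (q i)⁻¹ =
      (q i * (q j)⁻¹) * v * (q i * (q j)⁻¹)⁻¹ := by group
  rw [h1, h2]
  rfl

theorem sum_eq_two_mul_sTwo (hq : IsAxis (v : SL2Z) n q H) (hv : Hyperbolic (v : SL2Z))
    (hmem : ∀ k, q k ∈ Gamma) :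
    ∑ i ∈ Finset.range n, ∑ j ∈ Finset.range n,
      (if Linked (fixedSet ((q i)⁻¹ * v * q i)) (fixedSet ((q j)⁻¹ * v * q j)) then (1 : ℚ) else 0) *
        weight H i j = 2 * sTwo v := by
  have hsurj := hq.toDoubleCoset_surjective hv hmem
  have : Finite (Quot (DoubleCosetRel v)) := Finite.of_surjective _ hsurj
  have := Fintype.ofFinite (Quot (DoubleCosetRel v))
  rw [sTwo_eq, Nat.card_eq_fintype_card, Finset.sum_range]
  simp_rw [Finset.sum_range]
  rw [← Fintype.sum_prod_type' (f := fun i j : Fin n =>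
    (if Linked (fixedSet ((q (i : ℕ))⁻¹ * v * q (i : ℕ))) (fixedSet ((q (j : ℕ))⁻¹ * v * q (j : ℕ)))
      then (1 : ℚ) else 0) * weight H (i : ℕ) (j : ℕ))]
  simp_rw [linked_iff_goodConj hv hmem, ite_mul, one_mul, zero_mul]
  rw [← Finset.sum_filter, Finset.sum_subtype (p := fun x : Fin n × Fin n =>
    GoodConj v (⟨q (x.1 : ℕ), hmem _⟩ * ⟨q (x.2 : ℕ), hmem _⟩⁻¹)) _ (by simp),
    ← Fintype.sum_fiberwise (toDoubleCoset hmem)]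
  simp_rw [hq.sum_fiber hv hmem]
  simp [mul_comm]

end IsAxis

lemma commute_of_sq_eq_one {u : SL2Z} (hu : u ^ 2 = 1) (g : SL2Z) : Commute g u := by
  have hinv : u = u⁻¹ := by rw [eq_inv_iff_mul_eq_one, ← sq, hu]
  have hM := congrArg (Subtype.val : SL2Z → Matrix (Fin 2) (Fin 2) ℤ) hinv
  change (u : Matrix (Fin 2) (Fin 2) ℤ) = ((u⁻¹ : SL2Z) : Matrix (Fin 2) (Fin 2) ℤ) at hM
  rw [Matrix.SpecialLinearGroup.coe_inv, Matrix.adjugate_fin_two] at hM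
  have h00 : u.1 0 0 = u.1 1 1 := by simpa using congrFun (congrFun hM 0) 0
  have h01 : u.1 0 1 = - u.1 0 1 := by simpa using congrFun (congrFun hM 0) 1
  have h10 : u.1 1 0 = - u.1 1 0 := by simpa using congrFun (congrFun hM 1) 0
  have h01' : u.1 0 1 = 0 := by omega
  have h10' : u.1 1 0 = 0 := by omega
  ext i j
  fin_cases i <;> fin_cases j <;>
    simp [Matrix.mul_apply, h00, h01', h10', mul_comm]

lemma GoodConj.inv {v h : Gamma} (hh : GoodConj v h) : GoodConj v h⁻¹ := by
  have hv := hh.1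
  rw [goodConj_iff hv] at hh ⊢
  rw [traceComm_symm, ← traceComm_conj _ _ (h : SL2Z)]
  convert hh using 2
  push_cast
  group

/-- Inversion on the good double cosets. -/
def invDoubleCoset (v : Gamma) : Quot (DoubleCosetRel v) → Quot (DoubleCosetRel v) :=
  Quot.map (fun h => ⟨(h : Gamma)⁻¹, h.2.inv⟩) (by
    rintro h h' ⟨m, k, hmk⟩
    refine ⟨-k, -m, ?_⟩
    dsimp only
    rw [hmk]
    group)

lemma invDoubleCoset_involutive (v : Gamma) : Function.Involutive (invDoubleCoset v) := by
  intro y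
  induction y using Quot.ind with
  | mk h => simp [invDoubleCoset, Quot.map]

/-- The word read on the first `i + j` letters. -/
lemma IsLine.word_add (H : ℤ → Gen) (i j : ℕ) :
    IsLine.word H (i + j) = IsLine.word H i ++ IsLine.word (fun t => H (t + i)) j := by
  simp [IsLine.word, List.range_add, add_comm]

lemma IsLine.word_mul {H : ℤ → Gen} {d : ℕ} (h : ∀ t, H (t + d) = H t) (k : ℕ) :
    IsLine.word H (k * d) = (List.replicate k (IsLine.word H d)).flatten := by
  induction k with
  | zero => simp [IsLine.word]
  | succ k ih =>
    rw [Nat.succ_mul, add_comm, IsLine.word_add, List.replicate_succ, List.flatten_cons, ← ih]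
    simp [h]

namespace IsAxis

lemma invDoubleCoset_ne {v : Gamma} {n : ℕ} {q : ℤ → SL2Z} {H : ℤ → Gen}
    (hq : IsAxis (v : SL2Z) n q H) (y : Quot (DoubleCosetRel v)) : invDoubleCoset v y ≠ y := by
  induction y using Quot.ind with
  | mk h =>
    intro he
    obtain ⟨m, k, hmk⟩ := (Equivalence.quot_mk_eq_iff (doubleCosetRel_equivalence v) _ _).1 he.symm
    obtain ⟨h, hh⟩ := h
    have hT := (goodConj_iff hh.1).1 hh
    have hmk' := congrArg (Subtype.val : Gamma → SL2Z) hmk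
    push_cast at hmk'
    set g : SL2Z := (h : SL2Z)
    set V : SL2Z := (v : SL2Z)
    have hsq : (g * V ^ m) ^ 2 = V ^ (m - k) := by
      calc (g * V ^ m) ^ 2 = g * (V ^ m * g * V ^ k) * V ^ (m - k) := by rw [sq]; group
        _ = V ^ (m - k) := by rw [← hmk', mul_inv_cancel, one_mul]
    have hcomm : Commute V (g * V ^ m) := by
      by_cases hz : (V ^ (m - k)) ^ 2 = 1
      · refine commute_of_sq_eq_one ?_ V
        rw [hsq]
        rw [← zpow_natCast, ← zpow_mul] at hz
        have := hq.zpow_eq_one hz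
        simp only [Nat.cast_ofNat, mul_eq_zero, OfNat.ofNat_ne_zero, or_false] at this
        rw [this, zpow_zero]
      · refine commute_of_commute_of_ne (Commute.self_zpow V _) ?_ hz
        rw [← hsq]
        exact Commute.self_pow _ 2
    have hconj : g * V * g⁻¹ = V := by
      calc g * V * g⁻¹ = (g * V ^ m) * V * (g * V ^ m)⁻¹ := by group
        _ = V := by rw [← hcomm.eq, mul_inv_cancel_right]
    rw [hconj, traceComm_of_commute (Commute.refl V)] at hT
    exact lt_irrefl _ hT

lemma even_sTwo {v : Gamma} {n : ℕ} {q : ℤ → SL2Z} {H : ℤ → Gen}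
    (hq : IsAxis (v : SL2Z) n q H) (hv : Hyperbolic (v : SL2Z)) (hmem : ∀ k, q k ∈ Gamma) :
    2 ∣ sTwo v := by
  have : Finite (Quot (DoubleCosetRel v)) :=
    Finite.of_surjective _ (hq.toDoubleCoset_surjective hv hmem)
  have := Fintype.ofFinite (Quot (DoubleCosetRel v))
  rw [sTwo_eq, Nat.card_eq_fintype_card]
  have hinv := invDoubleCoset_involutive v
  have hsupp : hinv.toPerm.support = Finset.univ :=
    Finset.eq_univ_of_forall fun y => Equiv.Perm.mem_support.2 (hq.invDoubleCoset_ne y)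
  have h2 := Equiv.Perm.two_dvd_card_support (σ := hinv.toPerm)
    (by ext y; simp [sq, hinv y])
  rwa [hsupp] at h2

/-- A root of the translation shortens the period of the axis. -/
lemma exists_period_of_eq_pow {v : SL2Z} {n : ℕ} {q : ℤ → SL2Z} {H : ℤ → Gen}
    (hq : IsAxis v n q H) (hv : Hyperbolic v) (hmem : ∀ k, q k ∈ Gamma) {u : SL2Z}
    (hu : u ∈ Gamma) {r : ℕ} (hr : v = u ^ r) : ∃ d : ℕ, n = r * d ∧ ∀ t, H (t + d) = H t := by
  have hcomm : Commute u v := hr ▸ Commute.self_pow u r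
  obtain ⟨k, l, hkl⟩ := hq.exists_common_vertex hv hmem hu (by
    rw [hcomm.eq, mul_inv_cancel_right, traceComm_of_commute (Commute.refl v)])
  have hshift : ∀ m : ℤ, q (k + m * n) = u * q (l + m * n) := by
    intro m
    rw [hq.translate_zpow, hq.translate_zpow, hkl, ← mul_assoc, ← mul_assoc,
      (hcomm.zpow_right m).eq]
  have hall : ∀ t, H (k + t) = H (l + t) ∧ q (k + t) = u * q (l + t) := by
    intro t
    have hn : (1 : ℤ) ≤ n := by exact_mod_cast hq.pos
    have h1 : |t| ≤ |t| * n := le_mul_of_one_le_right (abs_nonneg t) hn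
    have h2 := neg_abs_le t
    have h3 := le_abs_self t
    obtain ⟨s, hs⟩ := Int.le.dest (show -|t| * n ≤ t by linarith)
    have := (hq.sync_of_le (hq.toIsLine.smul u) (hshift (-|t|)) (hshift (|t| + 1))
      (by linarith) (by linarith)).2 s (by linarith)
    rwa [add_assoc, add_assoc, hs] at this
  have hH : ∀ t, H (t + (k - l)) = H t := by
    intro t
    have := (hall (t - l)).1
    rwa [show k + (t - l) = t + (k - l) by ring, add_sub_cancel] at this
  have hqu : ∀ t, q (t + (k - l)) = u * q t := by
    intro t
    have := (hall (t - l)).2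
    rwa [show k + (t - l) = t + (k - l) by ring, add_sub_cancel] at this
  have hpow : ∀ m : ℕ, q (0 + m * (k - l)) = u ^ m * q 0 := by
    intro m
    induction m with
    | zero => simp
    | succ m ih =>
      rw [Nat.cast_succ, add_mul, one_mul, ← add_assoc, hqu, ih, pow_succ', mul_assoc]
  have hn : (n : ℤ) = r * (k - l) := by
    have h1 := hq.translate 0
    rw [hr, ← hpow, zero_add, zero_add] at h1
    exact hq.injective h1
  have hpos : 0 < k - l := by
    have : (0 : ℤ) < r * (k - l) := by rw [← hn]; exact_mod_cast hq.pos
    exact pos_of_mul_pos_right this (by positivity)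
  obtain ⟨d, hd⟩ := Int.eq_ofNat_of_zero_le hpos.le
  rw [hd] at hn hH
  exact ⟨d, by exact_mod_cast hn, hH⟩

end IsAxis

/-- The bi-infinite periodic sequence of letters of a cyclic word. -/
def letterAt (w : List Gen) (k : ℤ) : Gen := cget6 w (k % w.length).toNat

/-- The axis of a cyclic word. -/
def axisPath (w : List Gen) (k : ℤ) : SL2Z :=
  phi6 w ^ (k / w.length) * phi6 (w.take (k % w.length).toNat)

lemma axisPath_mem (w : List Gen) (k : ℤ) : axisPath w k ∈ Gamma :=
  mul_mem (zpow_mem (phi6_mem w) _) (phi6_mem _)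

lemma letterAt_natCast (w : List Gen) (i : ℕ) : letterAt w i = cget6 w i := by
  rw [letterAt, cget6, cget6, ← Int.natCast_mod, Int.toNat_natCast, Nat.mod_mod]

lemma letterAt_add_length (w : List Gen) (k : ℤ) : letterAt w (k + w.length) = letterAt w k := by
  simp [letterAt]

lemma letterAt_natCast_sub_one {w : List Gen} (hw : 0 < w.length) (i : ℕ) :
    letterAt w (i - 1) = cget6 w (i + w.length - 1) := by
  rw [← letterAt_natCast, ← letterAt_add_length]
  congr 1
  rw [Nat.cast_sub (by omega)]
  push_cast
  ring

lemma word_letterAt (w : List Gen) : IsLine.word (letterAt w) w.length = w := by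
  refine List.ext_getElem (by simp [IsLine.word]) fun i h1 h2 => ?_
  simp only [IsLine.word, List.getElem_map, List.getElem_range]
  rw [letterAt_natCast, cget6, Nat.mod_eq_of_lt h2, List.getD_eq_getElem]

lemma axisPath_add_mul {w : List Gen} (hw : 0 < w.length) {r : ℕ} (hr : r ≤ w.length) (c : ℤ) :
    axisPath w (r + w.length * c) = phi6 w ^ c * phi6 (w.take r) := by
  have hw' : (w.length : ℤ) ≠ 0 := by omega
  rw [axisPath, Int.add_mul_ediv_left _ _ hw', Int.add_mul_emod_self_left]
  rcases hr.lt_or_eq with h | rfl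
  · rw [Int.ediv_eq_zero_of_lt (by omega) (by omega), Int.emod_eq_of_lt (by omega) (by omega),
      zero_add, Int.toNat_natCast]
  · rw [Int.ediv_self hw', Int.emod_self, zpow_one_add, List.take_length, Int.toNat_zero,
      List.take_zero, phi6_nil, mul_one, ← zpow_one_add, add_comm, zpow_add_one]

lemma isAxis_axisPath {w : List Gen} (hcr : CyclRed6 w) :
    IsAxis (phi6 w) w.length (axisPath w) (letterAt w) where
  pos := List.length_pos_of_ne_nil hcr.1
  translate t := by
    have hpos := List.length_pos_of_ne_nil hcr.1
    rw [axisPath, axisPath, Int.add_emod_right, Int.add_ediv_of_dvd_right (dvd_refl _),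
      Int.ediv_self (by omega), add_comm, zpow_one_add, mul_assoc]
  step t := by
    have hpos := List.length_pos_of_ne_nil hcr.1
    have hpos' : (0 : ℤ) < w.length := by exact_mod_cast hpos
    obtain ⟨r, hr⟩ := Int.eq_ofNat_of_zero_le (Int.emod_nonneg t hpos'.ne')
    have hlt : r < w.length := by
      have := Int.emod_lt_of_pos t hpos'
      omega
    have ht : t = r + w.length * (t / w.length) := by
      rw [← hr]
      exact (Int.emod_add_mul_ediv t w.length).symm
    have htake : phi6 (w.take (r + 1)) = phi6 (w.take r) * genM (letterAt w t) := by
      rw [letterAt, hr, Int.toNat_natCast, cget6, Nat.mod_eq_of_lt hlt, List.getD_eq_getElem _ _ hlt,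
        List.take_succ_eq_append_getElem hlt, phi6_append, phi6_cons, phi6_nil, mul_one]
    have h1 := axisPath_add_mul hpos hlt.le (t / w.length)
    have h2 := axisPath_add_mul hpos hlt (t / w.length)
    rw [← ht] at h1
    rw [Nat.cast_succ, add_right_comm, ← ht] at h2
    rw [h1, h2, htake, mul_assoc]
  not_bad t := by
    have hpos := List.length_pos_of_ne_nil hcr.1
    have hpos' : (0 : ℤ) < w.length := by exact_mod_cast hpos
    obtain ⟨r, hr⟩ := Int.eq_ofNat_of_zero_le (Int.emod_nonneg t hpos'.ne')
    have hlt : r < w.length := by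
      have := Int.emod_lt_of_pos t hpos'
      omega
    have h := hcr.2 r hlt
    have h1 : letterAt w t = cget6 w r := by rw [letterAt, hr, Int.toNat_natCast]
    have h2 : letterAt w (t + 1) = cget6 w (r + 1) := by
      rw [← letterAt_natCast, letterAt, letterAt, ← Int.emod_add_emod, hr]
      push_cast
      rfl
    rwa [h1, h2]

lemma Primitive6.eq_of_period {w : List Gen} (hp : Primitive6 w) (hw : 0 < w.length) {k d : ℕ}
    (hk : w.length = k * d) (hd : ∀ t, letterAt w (t + d) = letterAt w t) : k = 1 := by
  by_contra hk1
  have hk0 : k ≠ 0 := by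
    rintro rfl
    omega
  have hd0 : 0 < d := Nat.pos_of_mul_pos_left (hk ▸ hw)
  refine hp ⟨IsLine.word (letterAt w) d, k, by omega, ?_, 0, ?_⟩
  · simp only [IsLine.word, List.length_map, List.length_range]
    rw [hk]
    exact lt_mul_of_one_lt_left hd0 (by omega)
  · rw [List.rotate_zero, ← IsLine.word_mul hd, ← hk, word_letterAt]

lemma axisPath_of_le {w : List Gen} (hw : 0 < w.length) {r : ℕ} (hr : r ≤ w.length) :
    axisPath w r = phi6 (w.take r) := by
  have := axisPath_add_mul hw hr 0
  rwa [mul_zero, add_zero, zpow_zero, one_mul] at this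

lemma phi6_rotate {w : List Gen} {i : ℕ} (hi : i < w.length) :
    phi6 (w.rotate i) = (axisPath w i)⁻¹ * phi6 w * axisPath w i := by
  have h : phi6 w = phi6 (w.take i) * phi6 (w.drop i) := by
    rw [← phi6_append, List.take_append_drop]
  rw [axisPath_of_le (by omega) hi.le, List.rotate_eq_drop_append_take hi.le, phi6_append, h,
    inv_mul_cancel_left]

lemma hyperbolic_phi6 {w : List Gen} (hn : 2 ≤ w.length) (hcr : CyclRed6 w)
    (hp : Primitive6 w) : Hyperbolic (phi6 w) := by
  have hq := isAxis_axisPath hcr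
  have hne : ∃ t : ℕ, t < w.length ∧ letterAt w t ≠ letterAt w 0 := by
    by_contra! hcon
    have hconst : ∀ t, letterAt w t = letterAt w 0 := by
      intro t
      have hlt := Int.emod_lt_of_pos t (show (0 : ℤ) < w.length by omega)
      have hnn := Int.emod_nonneg t (show (w.length : ℤ) ≠ 0 by omega)
      rw [← hcon (t % w.length).toNat (by omega), Int.toNat_of_nonneg hnn]
      simp [letterAt]
    have := hp.eq_of_period (by omega) (mul_one w.length).symm fun t =>
      (hconst _).trans (hconst _).symm
    omega
  have h := hq.toIsLine.hyperbolic_of_periodic (n := w.length) (by omega)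
    (letterAt_add_length w) hne
  have h0 := axisPath_of_le (w := w) (by omega) (Nat.zero_le _)
  rw [Nat.cast_zero, List.take_zero, phi6_nil] at h0
  rwa [h0, axisPath_of_le (by omega) le_rfl, List.take_length, inv_one, one_mul] at h

lemma notProperPower_phi6 {w : List Gen} (hcr : CyclRed6 w) (hp : Primitive6 w)
    (hv : Hyperbolic (phi6 w)) : NotProperPower ⟨phi6 w, phi6_mem w⟩ := by
  rintro ⟨u, k, hk, huk⟩
  obtain ⟨d, hd, hper⟩ := (isAxis_axisPath hcr).exists_period_of_eq_pow hv (axisPath_mem w) u.2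
    (r := k) (by simpa using congrArg (Subtype.val : Gamma → SL2Z) huk)
  have := hp.eq_of_period (List.length_pos_of_ne_nil hcr.1) hd hper
  omega

lemma Iγ_of_notProperPower {v : Gamma} (hv : NotProperPower v) :
    Iγ v = ((sTwo v / 2 : ℕ) : ℤ) := by
  have h : ∃ p : Gamma × ℕ, 1 ≤ p.2 ∧ NotProperPower p.1 ∧ v = p.1 ^ p.2 :=
    ⟨(v, 1), le_rfl, hv, (pow_one v).symm⟩
  rw [Iγ, dif_pos h]
  obtain ⟨h1, -, h3⟩ := h.choose_spec
  have h2 : h.choose.2 = 1 := by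
    by_contra hne
    exact hv ⟨_, _, by omega, h3⟩
  rw [h2, pow_one] at h3
  rw [h2, ← h3]
  push_cast
  ring

theorem almost_simple_geodesics_stmt12 (w : List Gen) (hn : 2 ≤ w.length)
    (hcr : CyclRed6 w) (hp : Primitive6 w) :
    (∀ i : ℕ, i < w.length → Hyperbolic (phi6 (w.rotate i))) ∧
    (I6 w : ℚ) = (1 / 4) *
      ∑ i ∈ Finset.range w.length, ∑ j ∈ Finset.range w.length,
        (if Linked (fixedSet (phi6 (w.rotate i))) (fixedSet (phi6 (w.rotate j)))
            then (1 : ℚ) else 0) *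
          ((({cget6 w i, genInv (cget6 w (i + w.length - 1)),
              cget6 w j, genInv (cget6 w (j + w.length - 1))} : Finset Gen).card : ℚ) - 2) := by
  have hv := hyperbolic_phi6 hn hcr hp
  have hq : IsAxis (((⟨phi6 w, phi6_mem w⟩ : Gamma)) : SL2Z) w.length (axisPath w) (letterAt w) :=
    isAxis_axisPath hcr
  refine ⟨fun i hi => ?_, ?_⟩
  · rw [phi6_rotate hi]
    exact (hyperbolic_conj' _).2 hv
  · have hsum := hq.sum_eq_two_mul_sTwo hv (axisPath_mem w)
    obtain ⟨m, hm⟩ := hq.even_sTwo hv (axisPath_mem w)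
    rw [I6, Iγ_of_notProperPower (notProperPower_phi6 hcr hp hv), hm,
      Nat.mul_div_cancel_left _ two_pos]
    rw [hm] at hsum
    have hw : 0 < w.length := by omega
    trans (1 / 4) * (2 * ((2 * m : ℕ) : ℚ))
    · push_cast
      ring
    · rw [← hsum]
      congr 1
      refine Finset.sum_congr rfl fun i hi => Finset.sum_congr rfl fun j hj => ?_
      rw [phi6_rotate (Finset.mem_range.1 hi), phi6_rotate (Finset.mem_range.1 hj),
        IsAxis.weight, letterAt_natCast_sub_one hw, letterAt_natCast_sub_one hw,
        letterAt_natCast, letterAt_natCast]
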